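/- arXiv:1909.01644 — 2 statements merged into one kernel-verified Lean document; each statement's English description precedes it below -/
import Mathlib

section
/- Let z₀ = π/2 + iπ/2 and z₁ = π/2 − iπ/2. Suppose f = f₀ + h on D, where (i) f₀(z) = (1/(2πi)) ∮_{∂D} g(u)/(u − z) du for some g : ∂D → ℂ integrable on ∂D with ∫_{∂D} |g(u)| log⁺(|g(u)|) |du| < ∞, and (ii) h is holomorphic on D with ∫_D |h(z)|² |z − z₀|^{−2} |z − z₁|^{−2} dA(z) < ∞. Then f ∈ A²(Δ) + A²(π − Δ); moreover every function in A²(Δ) + A²(π − Δ) belongs to A²(D). -/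
open MeasureTheory Set

noncomputable section

/-- The open sector `Δ = {z : |arg z| < π/4}`. -/
def SectorDelta : Set ℂ := {z : ℂ | 0 < z.re ∧ |z.im| < z.re}

/-- The reflected sector `π − Δ`. -/
def SectorPiDelta : Set ℂ := (fun z => (Real.pi : ℂ) - z) '' SectorDelta

/-- The open square `D = Δ ∩ (π − Δ)` with vertices `0, π/2 − iπ/2, π, π/2 + iπ/2`. -/
def SquareD : Set ℂ := SectorDelta ∩ SectorPiDelta

/-- Membership in the Bergman space `A²(Ω)`. -/
def MemA2 (Ω : Set ℂ) (f : ℂ → ℂ) : Prop :=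
  DifferentiableOn ℂ f Ω ∧ ∫⁻ z in Ω, ENNReal.ofReal (‖f z‖ ^ 2) < ⊤

/-- Membership in the weighted Bergman space `A²(Ω, w)`. -/
def MemA2W (Ω : Set ℂ) (w : ℂ → ℝ) (f : ℂ → ℂ) : Prop :=
  DifferentiableOn ℂ f Ω ∧ ∫⁻ z in Ω, ENNReal.ofReal (‖f z‖ ^ 2 * w z) < ⊤

/-- `log⁺ t = max (log t) 0`. -/
def logPlus (t : ℝ) : ℝ := Real.log (max t 1)

/-- Starting vertices of the four sides of `∂D`, counterclockwise. -/
def sideStart : Fin 4 → ℂ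
  | 0 => 0
  | 1 => ((Real.pi / 2 : ℝ) : ℂ) * (1 - Complex.I)
  | 2 => ((Real.pi : ℝ) : ℂ)
  | 3 => ((Real.pi / 2 : ℝ) : ℂ) * (1 + Complex.I)

/-- Direction vectors of the four sides of `∂D`, counterclockwise. -/
def sideDir : Fin 4 → ℂ
  | 0 => ((Real.pi / 2 : ℝ) : ℂ) * (1 - Complex.I)
  | 1 => ((Real.pi / 2 : ℝ) : ℂ) * (1 + Complex.I)
  | 2 => ((Real.pi / 2 : ℝ) : ℂ) * (Complex.I - 1)
  | 3 => -(((Real.pi / 2 : ℝ) : ℂ) * (1 + Complex.I))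

/-- Parametrization of the `k`-th side of `∂D`. -/
def sidePath (k : Fin 4) (t : ℝ) : ℂ := sideStart k + (t : ℂ) * sideDir k

/-- `g` is arclength-integrable on `∂D` (each side has constant speed). -/
def BoundaryIntegrable (g : ℂ → ℂ) : Prop :=
  ∀ k : Fin 4, IntervalIntegrable (fun t => ‖g (sidePath k t)‖) volume 0 1

/-- `∫_{∂D} |g| log⁺|g| |du| < ∞` (each side has constant speed). -/
def BoundaryLlogL (g : ℂ → ℂ) : Prop :=
  ∀ k : Fin 4, IntervalIntegrable
    (fun t => ‖g (sidePath k t)‖ * logPlus ‖g (sidePath k t)‖) volume 0 1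

/-- The Cauchy integral `(1/(2πi)) ∮_{∂D} g(u)/(u − z) du`, `∂D` counterclockwise. -/
def cauchyD (g : ℂ → ℂ) (z : ℂ) : ℂ :=
  (2 * (Real.pi : ℂ) * Complex.I)⁻¹ *
    ∑ k : Fin 4, ∫ t in (0:ℝ)..1, g (sidePath k t) * sideDir k / (sidePath k t - z)

/-- The Cauchy transform `(𝒞g)(z) = (1/(iπ)) ∫_ℝ g(t)/(t − z) dt` on the upper half-plane. -/
def cauchyTransform (g : ℝ → ℂ) (z : ℂ) : ℂ :=
  (Complex.I * (Real.pi : ℂ))⁻¹ * ∫ t : ℝ, g t / ((t : ℂ) - z)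


lemma radial_lintegral (f : ℝ → ENNReal) (hf : Measurable f) :
    ∫⁻ w : ℂ, f ‖w‖ = ENNReal.ofReal (2 * Real.pi) * ∫⁻ r in Ioi (0:ℝ), ENNReal.ofReal r * f r := by
  rw [← Complex.lintegral_comp_polarCoord_symm]
  have h1 : ∀ p ∈ polarCoord.target, ENNReal.ofReal p.1 • f ‖Complex.polarCoord.symm p‖
      = ENNReal.ofReal p.1 * f p.1 := by
    intro p hp
    rw [polarCoord_target] at hp
    have : (0:ℝ) < p.1 := hp.1
    rw [Complex.norm_polarCoord_symm, abs_of_pos this, smul_eq_mul]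
  rw [setLIntegral_congr_fun (by rw [polarCoord_target]; measurability) h1, polarCoord_target,
    Measure.volume_eq_prod, ← Measure.prod_restrict, lintegral_prod]
  · simp only [lintegral_const, Measure.restrict_apply MeasurableSet.univ, univ_inter, Real.volume_Ioo]
    rw [lintegral_mul_const _ (by fun_prop), mul_comm]
    congr 2; ring
  · fun_prop

lemma radial_bound (δ : ℝ) (h0 : 0 < δ) (h1 : δ ≤ 1) :
    ∫⁻ w : ℂ, ENNReal.ofReal (1 / ((1 + ‖w‖^2) * (‖w‖ * max ‖w‖ δ))) ≤
      ENNReal.ofReal (2 * Real.pi * (1 + Real.pi + Real.log (1/δ))) := by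
  rw [radial_lintegral (fun r => ENNReal.ofReal (1 / ((1 + r^2) * (r * max r δ)))) (by fun_prop),
    ENNReal.ofReal_mul (p := 2 * Real.pi) (q := 1 + Real.pi + Real.log (1/δ)) (by positivity)]
  refine mul_le_mul' le_rfl ?_
  have hlog : 0 ≤ Real.log (1/δ) := Real.log_nonneg (by rw [le_div_iff₀ h0]; linarith)
  have e1 : Ioi (0:ℝ) = Ioc 0 δ ∪ (Ioc δ 1 ∪ Ioi 1) := by
    rw [Ioc_union_Ioi_eq_Ioi h1, Ioc_union_Ioi_eq_Ioi h0.le]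
  have hcongr : ∀ r ∈ Ioi (0:ℝ), ENNReal.ofReal r * ENNReal.ofReal (1 / ((1 + r^2) * (r * max r δ)))
      = ENNReal.ofReal (1 / ((1+r^2) * max r δ)) := by
    intro r hr
    have hr : 0 < r := hr
    rw [← ENNReal.ofReal_mul hr.le]
    have : 0 < max r δ := lt_max_of_lt_left hr
    congr 1; field_simp
  rw [setLIntegral_congr_fun measurableSet_Ioi hcongr, e1]
  refine (lintegral_union_le _ _ _).trans ?_
  have b1 : ∫⁻ r in Ioc 0 δ, ENNReal.ofReal (1 / ((1+r^2) * max r δ)) ≤ ENNReal.ofReal 1 := by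
    calc _ ≤ ∫⁻ r in Ioc 0 δ, ENNReal.ofReal (1/δ) := by
          apply setLIntegral_mono (by fun_prop)
          intro r hr
          apply ENNReal.ofReal_le_ofReal
          apply one_div_le_one_div_of_le h0
          nlinarith [le_max_right r δ, sq_nonneg r]
      _ = ENNReal.ofReal 1 := by
          rw [setLIntegral_const, Real.volume_Ioc, ← ENNReal.ofReal_mul (by positivity)]
          congr 1; field_simp; simp
  have b2 : ∫⁻ r in Ioc δ 1, ENNReal.ofReal (1 / ((1+r^2) * max r δ)) ≤ ENNReal.ofReal (Real.log (1/δ)) := by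
    calc _ ≤ ∫⁻ r in Ioc δ 1, ENNReal.ofReal (r⁻¹) := by
          apply setLIntegral_mono (by fun_prop)
          intro r hr
          have : 0 < r := h0.trans hr.1
          apply ENNReal.ofReal_le_ofReal
          rw [← one_div]
          apply one_div_le_one_div_of_le this
          nlinarith [le_max_left r δ, sq_nonneg r]
      _ = ENNReal.ofReal (Real.log (1/δ)) := by
          rw [← integral_inv_of_pos h0 one_pos, intervalIntegral.integral_of_le h1,
            ofReal_integral_eq_lintegral_ofReal]
          · apply (intervalIntegrable_iff_integrableOn_Ioc_of_le h1).1
            apply intervalIntegral.intervalIntegrable_inv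
            · intro x hx; rw [uIcc_of_le h1] at hx; exact (h0.trans_le hx.1).ne'
            · exact continuousOn_id
          · filter_upwards [ae_restrict_mem measurableSet_Ioc] with x hx
            exact inv_nonneg.2 (h0.trans hx.1).le
  have b3 : ∫⁻ r in Ioi 1, ENNReal.ofReal (1 / ((1+r^2) * max r δ)) ≤ ENNReal.ofReal Real.pi := by
    calc _ ≤ ∫⁻ r in Ioi 1, ENNReal.ofReal ((1+r^2)⁻¹) := by
          apply setLIntegral_mono (by fun_prop)
          intro r hr
          have : 1 < r := hr
          apply ENNReal.ofReal_le_ofReal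
          rw [← one_div]
          apply one_div_le_one_div_of_le (by positivity)
          nlinarith [le_max_left r δ, sq_nonneg r]
      _ ≤ ∫⁻ r, ENNReal.ofReal ((1+r^2)⁻¹) := setLIntegral_le_lintegral _ _
      _ = ENNReal.ofReal Real.pi := by
          rw [← integral_univ_inv_one_add_sq, ofReal_integral_eq_lintegral_ofReal integrable_inv_one_add_sq]
          filter_upwards with x
          positivity
  calc _ ≤ ENNReal.ofReal 1 + (ENNReal.ofReal (Real.log (1/δ)) + ENNReal.ofReal Real.pi) :=
        add_le_add b1 ((lintegral_union_le _ _ _).trans (add_le_add b2 b3))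
    _ = _ := by
        rw [← ENNReal.ofReal_add hlog Real.pi_pos.le, ← ENNReal.ofReal_add zero_le_one (by positivity)]
        congr 1; ring

lemma young (a b : ℝ) (ha : 0 ≤ a) (hb : 0 ≤ b) : a * b ≤ a * logPlus a + Real.exp b := by
  unfold logPlus
  rcases le_or_gt a 1 with h | h
  · rw [max_eq_right h, Real.log_one, mul_zero, zero_add]
    nlinarith [Real.add_one_le_exp b]
  · rw [max_eq_left h.le]
    have h1 := Real.add_one_le_exp (b - Real.log a)
    have h2 : Real.exp b = a * Real.exp (b - Real.log a) := by
      rw [Real.exp_sub, Real.exp_log (by linarith)]; field_simp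
    rw [h2]; nlinarith

lemma kernel_pt (x y P ε M δ : ℝ) (hx : 0 ≤ x) (hy : 0 ≤ y) (hε : 0 < ε) (hP : ε ≤ P) (hM : 0 ≤ M)
    (hxP : x ≤ P + M) (hδ : 0 < δ) (hxy : x ≤ y) (hd : 2 * δ ≤ x + y) :
    1 / (x * y * P^2) ≤ (2 + (1 + 2 * M^2) / ε^2) * (1 / ((1+x^2) * (x * max x δ))) := by
  rcases hx.eq_or_lt with rfl | hx
  · simp
  have hy : 0 < y := hx.trans_le hxy
  have hP0 : 0 < P := hε.trans_le hP
  have hm : max x δ ≤ y := max_le hxy (by linarith)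
  have hC : 1 + x^2 ≤ (2 + (1 + 2 * M^2) / ε^2) * P^2 := by
    have : (1 + 2*M^2) ≤ (1 + 2 * M^2) / ε^2 * P^2 := by
      rw [div_mul_eq_mul_div, le_div_iff₀ (by positivity)]
      have : ε^2 ≤ P^2 := by gcongr
      gcongr
    nlinarith [sq_nonneg (P - M)]
  have hm0 : 0 < max x δ := lt_max_of_lt_left hx
  rw [mul_one_div, div_le_div_iff₀ (by positivity) (by positivity)]
  calc 1 * ((1+x^2) * (x * max x δ)) ≤ ((2 + (1 + 2 * M^2) / ε^2) * P^2) * (x * y) := by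
        rw [one_mul]; gcongr
    _ = _ := by ring

lemma kernel_pt' (x y P ε M δ : ℝ) (hx : 0 ≤ x) (hy : 0 ≤ y) (hε : 0 < ε) (hP : ε ≤ P) (hM : 0 ≤ M)
    (hxP : x ≤ P + M) (hyP : y ≤ P + M) (hδ : 0 < δ) (hd : 2 * δ ≤ x + y) :
    1 / (x * y * P^2) ≤ (2 + (1 + 2 * M^2) / ε^2) * (1 / ((1+x^2) * (x * max x δ)))
      + (2 + (1 + 2 * M^2) / ε^2) * (1 / ((1+y^2) * (y * max y δ))) := by
  have hm0 : 0 < max x δ := lt_max_of_lt_right hδ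
  have hm1 : 0 < max y δ := lt_max_of_lt_right hδ
  rcases le_total x y with h | h
  · have := kernel_pt x y P ε M δ hx hy hε hP hM hxP hδ h hd
    have : 0 ≤ (2 + (1 + 2 * M^2) / ε^2) * (1 / ((1+y^2) * (y * max y δ))) := by positivity
    linarith
  · have := kernel_pt y x P ε M δ hy hx hε hP hM hyP hδ h (by linarith)
    have : 0 ≤ (2 + (1 + 2 * M^2) / ε^2) * (1 / ((1+x^2) * (x * max x δ))) := by positivity
    rw [mul_comm x y]
    linarith

lemma abs_rpow_fin (c : ℝ) (hc : 0 < c) :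
    ∫⁻ x in Ioo (-1:ℝ) 1, ENNReal.ofReal (Real.exp (Real.log (1/(c * |x|)) / 2)) < ⊤ := by
  have h1 : IntegrableOn (fun x : ℝ => Real.exp (Real.log (1/(c * ‖x‖)) / 2)) (Metric.ball 0 1) := by
    rw [integrableOn_fun_norm_addHaar volume (f := fun y => Real.exp (Real.log (1/(c * y)) / 2))]
    simp only [Module.finrank_self, Nat.sub_self, pow_zero, one_smul]
    have h2 : IntegrableOn (fun y : ℝ => (c^(-(1/2):ℝ)) * y ^ (-(1/2):ℝ)) (Ioo 0 1) := by
      apply Integrable.const_mul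
      have := intervalIntegral.intervalIntegrable_rpow' (a := 0) (b := 1) (r := -(1/2)) (by norm_num)
      rw [intervalIntegrable_iff_integrableOn_Ioo_of_le zero_le_one] at this
      exact this
    refine h2.congr_fun ?_ measurableSet_Ioo
    intro y hy
    have hy0 : 0 < y := hy.1
    simp only []
    rw [← Real.mul_rpow hc.le hy0.le, Real.rpow_def_of_pos (by positivity), one_div (c*y), Real.log_inv]
    congr 1; ring
  have h3 := h1.lintegral_lt_top
  rw [Real.ball_eq_Ioo] at h3
  simpa using h3

lemma core_bound (a v p : ℂ) (hv : v ≠ 0) (ε : ℝ) (hε : 0 < ε) (Ω : Set ℂ) (hΩm : MeasurableSet Ω)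
    (hΩ : ∀ z ∈ Ω, ε ≤ ‖z - p‖) (G : ℝ → ℝ) (hGm : Measurable G) (hG0 : ∀ t, 0 ≤ G t)
    (hG1 : IntegrableOn G (Ioc 0 1)) (hG2 : IntegrableOn (fun t => G t * logPlus (G t)) (Ioc 0 1)) :
    ∫⁻ z in Ω, (∫⁻ t in Ioc (0:ℝ) 1, ENNReal.ofReal (G t / (‖a + t * v - z‖ * ‖z - p‖)))^2 < ⊤ := by
  set M : ℝ := ‖a - p‖ + ‖v‖ with hMdef
  have hM : 0 ≤ M := by positivity
  set c : ℝ := min (‖v‖/2) 1 with hcdef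
  have hv' : 0 < ‖v‖ := norm_pos_iff.2 hv
  have hc : 0 < c := lt_min (by positivity) one_pos
  set C : ℝ := 2 + (1 + 2 * M^2) / ε^2 with hCdef
  have hC : 0 < C := by positivity
  set k : ℂ → ℝ → ENNReal := fun z t => ENNReal.ofReal (G t / (‖a + t * v - z‖ * ‖z - p‖)) with hk
  have hkm : Measurable (fun q : ℂ × ℝ => k q.1 q.2) := by
    simp only [hk]; fun_prop
  have hkm1 : ∀ z, Measurable (k z) := fun z => by simp only [hk]; fun_prop
  have hkm2 : ∀ t, Measurable (fun z => k z t) := fun t => by simp only [hk]; fun_prop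
  -- kernel bound
  have hK : ∀ t ∈ Ioc (0:ℝ) 1, ∀ s ∈ Ioc (0:ℝ) 1, s ≠ t → ∫⁻ z in Ω, k z t * k z s ≤
      ENNReal.ofReal (G t) * ENNReal.ofReal (G s *
        (2 * C * (2 * Real.pi * (1 + Real.pi + Real.log (1/(c * |s - t|)))))) := by
    intro t ht s hs hst
    have hst' : 0 < |s - t| := abs_pos.2 (sub_ne_zero.2 hst)
    have hst1 : |s - t| ≤ 1 := by rw [abs_le]; constructor <;> linarith [ht.1, ht.2, hs.1, hs.2]
    set δ := c * |s - t| with hδ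
    have hδ0 : 0 < δ := by positivity
    have hδ1 : δ ≤ 1 := by
      have : c ≤ 1 := min_le_right _ _
      nlinarith
    have hδd : 2 * δ ≤ ‖v‖ * |s - t| := by
      have : c ≤ ‖v‖/2 := min_le_left _ _
      nlinarith
    have hpt : ∀ z ∈ Ω, k z t * k z s ≤ ENNReal.ofReal (G t * G s * C) *
        (ENNReal.ofReal (1 / ((1 + ‖z - (a + t * v)‖^2) * (‖z - (a + t * v)‖ * max ‖z - (a + t * v)‖ δ)))
        + ENNReal.ofReal (1 / ((1 + ‖z - (a + s * v)‖^2) * (‖z - (a + s * v)‖ * max ‖z - (a + s * v)‖ δ)))) := by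
      intro z hz
      have hMt : ∀ r ∈ Ioc (0:ℝ) 1, ‖z - (a + r * v)‖ ≤ ‖z - p‖ + M := by
        intro r hr
        calc ‖z - (a + r * v)‖ = ‖(z - p) - (a - p) - r * v‖ := by congr 1; ring
          _ ≤ ‖z - p‖ + ‖a - p‖ + ‖(r:ℂ) * v‖ := (norm_sub_le _ _).trans (by gcongr; exact norm_sub_le _ _)
          _ ≤ ‖z - p‖ + M := by
            rw [norm_mul, Complex.norm_real, Real.norm_eq_abs, abs_of_pos hr.1]
            nlinarith [hr.2]
      have hd : 2 * δ ≤ ‖z - (a + t * v)‖ + ‖z - (a + s * v)‖ := by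
        refine hδd.trans ?_
        calc ‖v‖ * |s - t| = ‖(z - (a + t * v)) - (z - (a + s * v))‖ := by
              rw [← Real.norm_eq_abs, ← Complex.norm_real, ← norm_mul]; congr 1; push_cast; ring
          _ ≤ _ := norm_sub_le _ _
      have h := kernel_pt' ‖z - (a + t * v)‖ ‖z - (a + s * v)‖ ‖z - p‖ ε M δ (norm_nonneg _) (norm_nonneg _)
        hε (hΩ z hz) hM (hMt t ht) (hMt s hs) hδ0 hd
      have hgt := hG0 t
      have hgs := hG0 s
      change ENNReal.ofReal _ * ENNReal.ofReal _ ≤ _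
      rw [← ENNReal.ofReal_add (by positivity) (by positivity), ← ENNReal.ofReal_mul (by positivity),
        ← ENNReal.ofReal_mul (by positivity)]
      apply ENNReal.ofReal_le_ofReal
      rw [norm_sub_rev (a + t * v) z, norm_sub_rev (a + s * v) z]
      calc _ = (G t * G s) * (1 / (‖z - (a + t * v)‖ * ‖z - (a + s * v)‖ * ‖z - p‖^2)) := by
            rw [div_mul_div_comm, mul_one_div]; congr 1; ring
        _ ≤ (G t * G s) * _ := mul_le_mul_of_nonneg_left h (mul_nonneg (hG0 t) (hG0 s))
        _ = _ := by ring
    have htr : ∀ b : ℂ, ∫⁻ z, ENNReal.ofReal (1 / ((1 + ‖z - b‖^2) * (‖z - b‖ * max ‖z - b‖ δ)))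
        ≤ ENNReal.ofReal (2 * Real.pi * (1 + Real.pi + Real.log (1/δ))) := by
      intro b
      rw [lintegral_sub_right_eq_self (fun z : ℂ => ENNReal.ofReal (1 / ((1 + ‖z‖^2) * (‖z‖ * max ‖z‖ δ)))) b]
      exact radial_bound δ hδ0 hδ1
    have hlog : 0 ≤ Real.log (1/δ) := Real.log_nonneg (by rw [le_div_iff₀ hδ0]; linarith)
    calc ∫⁻ z in Ω, k z t * k z s ≤ _ := setLIntegral_mono (by fun_prop) hpt
      _ ≤ _ := setLIntegral_le_lintegral _ _
      _ ≤ ENNReal.ofReal (G t * G s * C) * (ENNReal.ofReal (2 * Real.pi * (1 + Real.pi + Real.log (1/δ)))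
          + ENNReal.ofReal (2 * Real.pi * (1 + Real.pi + Real.log (1/δ)))) := by
          rw [lintegral_const_mul _ (by fun_prop), lintegral_add_left (by fun_prop)]
          exact mul_le_mul' le_rfl (add_le_add (htr _) (htr _))
      _ = _ := by
          rw [← ENNReal.ofReal_add (by positivity) (by positivity), ← ENNReal.ofReal_mul
            (by have := hG0 t; have := hG0 s; positivity), ← ENNReal.ofReal_mul (hG0 t)]
          congr 1; ring
  -- bound in s
  set E : ℝ → ENNReal := fun x => ENNReal.ofReal (Real.exp (Real.log (1/(c * |x|)) / 2)) with hE
  have hEm : Measurable E := by simp only [hE]; fun_prop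
  set B0 := ∫⁻ x in Ioo (-1:ℝ) 1, E x with hB0
  have hB0f : B0 < ⊤ := abs_rpow_fin c hc
  set B1 := ∫⁻ s in Ioc (0:ℝ) 1, ENNReal.ofReal (G s) with hB1
  have hB1f : B1 < ⊤ := hG1.lintegral_lt_top
  set B2 := ∫⁻ s in Ioc (0:ℝ) 1, ENNReal.ofReal (G s * logPlus (G s)) with hB2
  have hB2f : B2 < ⊤ := hG2.lintegral_lt_top
  set C1 := 2 * C * (2 * Real.pi) with hC1
  have hC1p : 0 < C1 := by positivity
  set B := ENNReal.ofReal (C1 * (1 + Real.pi)) * B1 + (ENNReal.ofReal (2 * C1) * B2 + ENNReal.ofReal (2 * C1) * B0) with hB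
  have hBf : B < ⊤ := by
    simp only [hB, ENNReal.add_lt_top]
    exact ⟨ENNReal.mul_lt_top ENNReal.ofReal_lt_top hB1f, ENNReal.mul_lt_top ENNReal.ofReal_lt_top hB2f,
      ENNReal.mul_lt_top ENNReal.ofReal_lt_top hB0f⟩
  have hlp : ∀ x, 0 ≤ logPlus x := fun x => Real.log_nonneg (le_max_right _ _)
  have hlpm : Measurable logPlus := by unfold logPlus; fun_prop
  have hS : ∀ t ∈ Ioc (0:ℝ) 1, ∫⁻ s in Ioc (0:ℝ) 1, ENNReal.ofReal (G s *
        (2 * C * (2 * Real.pi * (1 + Real.pi + Real.log (1/(c * |s - t|)))))) ≤ B := by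
    intro t ht
    have hpt : ∀ s ∈ Ioc (0:ℝ) 1, ENNReal.ofReal (G s *
        (2 * C * (2 * Real.pi * (1 + Real.pi + Real.log (1/(c * |s - t|)))))) ≤
        ENNReal.ofReal (C1 * (1 + Real.pi)) * ENNReal.ofReal (G s) +
        (ENNReal.ofReal (2 * C1) * ENNReal.ofReal (G s * logPlus (G s)) + ENNReal.ofReal (2 * C1) * E (s - t)) := by
      intro s hs
      have hst1 : |s - t| ≤ 1 := by rw [abs_le]; constructor <;> linarith [ht.1, ht.2, hs.1, hs.2]
      have hlog : 0 ≤ Real.log (1/(c * |s - t|)) := by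
        rcases (abs_nonneg (s-t)).eq_or_lt with h | h
        · rw [← h]; simp
        · apply Real.log_nonneg
          rw [le_div_iff₀ (by positivity)]
          have : c ≤ 1 := min_le_right _ _
          nlinarith
      have hy := young (G s) (Real.log (1/(c * |s - t|)) / 2) (hG0 s) (by positivity)
      have h1 := hG0 s
      have h2 := hlp (G s)
      simp only [hE]
      rw [← ENNReal.ofReal_mul (by positivity), ← ENNReal.ofReal_mul (by positivity), ← ENNReal.ofReal_mul (by positivity),
        ← ENNReal.ofReal_add (by positivity) (by positivity), ← ENNReal.ofReal_add (by positivity) (by positivity)]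
      apply ENNReal.ofReal_le_ofReal
      have := mul_le_mul_of_nonneg_left hy hC1p.le
      simp only [hC1] at this ⊢
      linarith
    calc _ ≤ _ := setLIntegral_mono (by fun_prop) hpt
      _ = ENNReal.ofReal (C1 * (1 + Real.pi)) * B1 + (ENNReal.ofReal (2 * C1) * B2
            + ENNReal.ofReal (2 * C1) * ∫⁻ s in Ioc (0:ℝ) 1, E (s - t)) := by
          rw [lintegral_add_left (by fun_prop), lintegral_add_left (by fun_prop),
            lintegral_const_mul _ (by fun_prop), lintegral_const_mul _ (by fun_prop), lintegral_const_mul _ (by fun_prop)]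
      _ ≤ B := by
          rw [hB]
          refine add_le_add le_rfl (add_le_add le_rfl (mul_le_mul' le_rfl ?_))
          calc ∫⁻ s in Ioc (0:ℝ) 1, E (s - t) = ∫⁻ s in Ioo (0:ℝ) 1, E (s - t) := by
                rw [restrict_Ioo_eq_restrict_Ioc]
            _ ≤ ∫⁻ s, (Ioo (-1:ℝ) 1).indicator E (s - t) := by
                rw [← lintegral_indicator measurableSet_Ioo]
                apply lintegral_mono
                intro s
                by_cases hs : s ∈ Ioo (0:ℝ) 1
                · have : s - t ∈ Ioo (-1:ℝ) 1 := ⟨by linarith [hs.1, ht.2], by linarith [hs.2, ht.1]⟩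
                  simp [hs, this]
                · simp [hs]
            _ = B0 := by
                rw [lintegral_sub_right_eq_self, lintegral_indicator measurableSet_Ioo]
  calc ∫⁻ z in Ω, (∫⁻ t in Ioc (0:ℝ) 1, k z t)^2
      = ∫⁻ z in Ω, ∫⁻ t in Ioc (0:ℝ) 1, ∫⁻ s in Ioc (0:ℝ) 1, k z t * k z s := by
        congr 1; ext z
        rw [sq, ← lintegral_mul_const _ (hkm1 z)]
        congr 1; ext t
        rw [lintegral_const_mul _ (hkm1 z)]
    _ = ∫⁻ t in Ioc (0:ℝ) 1, ∫⁻ z in Ω, ∫⁻ s in Ioc (0:ℝ) 1, k z t * k z s := by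
        apply lintegral_lintegral_swap
        apply Measurable.aemeasurable
        apply Measurable.lintegral_prod_right' (f := fun q : (ℂ × ℝ) × ℝ => k q.1.1 q.1.2 * k q.1.1 q.2)
        simp only [hk]; fun_prop
    _ = ∫⁻ t in Ioc (0:ℝ) 1, ∫⁻ s in Ioc (0:ℝ) 1, ∫⁻ z in Ω, k z t * k z s := by
        congr 1; ext t
        apply lintegral_lintegral_swap
        apply Measurable.aemeasurable
        simp only [hk]; fun_prop
    _ ≤ ∫⁻ t in Ioc (0:ℝ) 1, ENNReal.ofReal (G t) * B := by
        apply setLIntegral_mono (by fun_prop)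
        intro t ht
        calc _ ≤ ∫⁻ s in Ioc (0:ℝ) 1, ENNReal.ofReal (G t) * ENNReal.ofReal (G s *
                (2 * C * (2 * Real.pi * (1 + Real.pi + Real.log (1/(c * |s - t|)))))) := by
              apply lintegral_mono_ae
              filter_upwards [ae_restrict_mem measurableSet_Ioc, ae_restrict_of_ae (Measure.ae_ne volume t)] with s hs hst
              exact hK t ht s hs hst
          _ ≤ _ := by
              rw [lintegral_const_mul _ (by fun_prop)]
              exact mul_le_mul' le_rfl (hS t ht)
    _ = B1 * B := by rw [lintegral_mul_const _ (by fun_prop)]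
    _ < ⊤ := ENNReal.mul_lt_top hB1f hBf

lemma memLp_two_of {μ : Measure ℂ} {f : ℂ → ℂ} (hf : AEStronglyMeasurable f μ)
    (h : ∫⁻ z, ‖f z‖ₑ^2 ∂μ < ⊤) : MemLp f 2 μ := by
  refine ⟨hf, ?_⟩
  rw [eLpNorm_lt_top_iff_lintegral_rpow_enorm_lt_top (by norm_num) (by norm_num)]
  simpa using h

lemma lint_of_memLp_two {μ : Measure ℂ} {f : ℂ → ℂ} (hf : MemLp f 2 μ) :
    ∫⁻ z, ‖f z‖ₑ^2 ∂μ < ⊤ := by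
  have := hf.2
  rw [eLpNorm_lt_top_iff_lintegral_rpow_enorm_lt_top (by norm_num) (by norm_num)] at this
  simpa using this

lemma ofReal_sq_norm (w : ℂ) : ENNReal.ofReal (‖w‖^2) = ‖w‖ₑ^2 := by
  rw [ENNReal.ofReal_pow (norm_nonneg _), ofReal_norm]

lemma hol_param {μ : Measure ℝ} {F : ℂ → ℝ → ℂ} {U : Set ℂ} (hU : IsOpen U)
    (hm : ∀ z ∈ U, AEStronglyMeasurable (F z) μ)
    (hd : ∀ᵐ t ∂μ, DifferentiableOn ℂ (fun z => F z t) U)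
    (hb : ∀ z ∈ U, ∃ r > 0, ∃ bound : ℝ → ℝ, Integrable bound μ ∧
      ∀ᵐ t ∂μ, ∀ w ∈ Metric.ball z r, ‖F w t‖ ≤ bound t) :
    DifferentiableOn ℂ (fun z => ∫ t, F z t ∂μ) U := by
  intro z hz
  obtain ⟨r₁, hr₁, bound, hbi, hbb⟩ := hb z hz
  obtain ⟨r₂, hr₂, hr₂U⟩ := Metric.isOpen_iff.1 hU z hz
  set r := min r₁ r₂ with hr
  have hr0 : 0 < r := lt_min hr₁ hr₂
  have hrU : Metric.ball z r ⊆ U := (Metric.ball_subset_ball (min_le_right _ _)).trans hr₂U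
  have hr1 : Metric.ball z r ⊆ Metric.ball z r₁ := Metric.ball_subset_ball (min_le_left _ _)
  have key := hasDerivAt_integral_of_dominated_loc_of_deriv_le (μ := μ) (F := F) (x₀ := z)
    (s := Metric.ball z (r/2)) (bound := fun t => bound t / (r/3)) (F' := fun w t => deriv (fun z => F z t) w)
    (Metric.ball_mem_nhds z (by positivity)) ?_ ?_ ?_ ?_ (hbi.div_const _) ?_
  · exact key.2.differentiableAt.differentiableWithinAt
  · filter_upwards [hU.mem_nhds hz] with w hw using hm w hw
  · refine hbi.mono' (hm z hz) ?_
    filter_upwards [hbb] with t ht using ht z (Metric.mem_ball_self hr₁)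
  · -- measurability of the derivative
    set e : ℕ → ℂ := fun n => ((r / 2 / ((n:ℝ) + 1) : ℝ) : ℂ) with he
    have he0 : ∀ n, e n ≠ 0 := by
      intro n; simp only [he]; rw [Complex.ofReal_ne_zero]; positivity
    have hen : ∀ n, z + e n ∈ Metric.ball z r := by
      intro n
      rw [Metric.mem_ball, dist_eq_norm, add_sub_cancel_left, he, Complex.norm_real, Real.norm_eq_abs,
        abs_of_pos (by positivity), div_lt_iff₀ (by positivity)]
      have : (0:ℝ) ≤ n := Nat.cast_nonneg n
      nlinarith
    have hel : Filter.Tendsto e Filter.atTop (nhds 0) := by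
      have h1 : Filter.Tendsto (fun n : ℕ => r / 2 / ((n:ℝ) + 1)) Filter.atTop (nhds 0) := by
        have := (tendsto_one_div_add_atTop_nhds_zero_nat (𝕜 := ℝ)).const_mul (r/2)
        simpa [div_eq_mul_inv] using this
      have := (Complex.continuous_ofReal.tendsto 0).comp h1
      rw [Complex.ofReal_zero] at this
      exact this
    apply aestronglyMeasurable_of_tendsto_ae Filter.atTop (f := fun n t => (e n)⁻¹ • (F (z + e n) t - F z t))
    · intro n
      exact ((hm _ (hrU (hen n))).sub (hm z hz)).const_smul (e n)⁻¹
    · filter_upwards [hd] with t ht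
      have h1 : HasDerivAt (fun z => F z t) (deriv (fun z => F z t) z) z :=
        (ht.differentiableAt (hU.mem_nhds hz)).hasDerivAt
      exact h1.tendsto_slope_zero.comp (tendsto_nhdsWithin_iff.2 ⟨hel, Filter.Eventually.of_forall he0⟩)
  · filter_upwards [hd, hbb] with t ht htb w hw
    have hsub : Metric.closedBall w (r/3) ⊆ Metric.ball z r := by
      intro x hx
      rw [Metric.mem_closedBall] at hx
      rw [Metric.mem_ball] at hw ⊢
      linarith [dist_triangle x w z]
    apply Complex.norm_deriv_le_of_forall_mem_sphere_norm_le (by positivity)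
    · apply DifferentiableOn.diffContOnCl
      rw [closure_ball _ (by positivity)]
      exact ht.mono (hsub.trans hrU)
    · intro x hx
      exact htb x (hr1 (hsub (Metric.sphere_subset_closedBall hx)))
  · filter_upwards [hd] with t ht w hw
    exact (ht.differentiableAt (hU.mem_nhds (hrU (Metric.ball_subset_ball (by linarith) hw)))).hasDerivAt

lemma seg_dist (a v z : ℂ) (hz : ∀ t ∈ Icc (0:ℝ) 1, a + t * v ≠ z) :
    ∃ r > 0, ∀ w ∈ Metric.ball z r, ∀ t ∈ Icc (0:ℝ) 1, r ≤ ‖a + t * v - w‖ := by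
  have hS : IsCompact ((fun t : ℝ => a + t * v) '' Icc (0:ℝ) 1) :=
    isCompact_Icc.image (by fun_prop)
  have : z ∈ ((fun t : ℝ => a + t * v) '' Icc (0:ℝ) 1)ᶜ := by
    rintro ⟨t, ht, h⟩; exact hz t ht h
  obtain ⟨r, hr, hrs⟩ := Metric.isOpen_iff.1 hS.isClosed.isOpen_compl z this
  refine ⟨r/2, by positivity, ?_⟩
  intro w hw t ht
  by_contra hlt
  push Not at hlt
  have : a + t * v ∈ Metric.ball z r := by
    rw [Metric.mem_ball] at hw ⊢
    rw [← dist_eq_norm] at hlt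
    linarith [dist_triangle (a + t * v) w z]
  exact hrs this ⟨t, ht, rfl⟩

lemma cauchy_seg (a v p : ℂ) (hv : v ≠ 0) (ε : ℝ) (hε : 0 < ε) (Ω : Set ℂ) (hΩo : IsOpen Ω)
    (hΩ : ∀ z ∈ Ω, ε ≤ ‖z - p‖) (hs : ∀ z ∈ Ω, ∀ t ∈ Icc (0:ℝ) 1, a + t * v ≠ z) (G : ℝ → ℂ)
    (h1 : IntervalIntegrable (fun t => ‖G t‖) volume 0 1)
    (h2 : IntervalIntegrable (fun t => ‖G t‖ * logPlus ‖G t‖) volume 0 1) :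
    DifferentiableOn ℂ (fun z => ∫ t in (0:ℝ)..1, G t * v / (a + t * v - z)) Ω ∧
    ∃ c : ℂ, MemLp (fun z => (∫ t in (0:ℝ)..1, G t * v / (a + t * v - z)) - c / (z - p)) 2
      (volume.restrict Ω) := by
  simp only [intervalIntegral.integral_of_le zero_le_one]
  rw [intervalIntegrable_iff_integrableOn_Ioc_of_le zero_le_one] at h1 h2
  by_cases hG : AEStronglyMeasurable G (volume.restrict (Ioc (0:ℝ) 1))
  swap
  · have h0 : ∀ z ∈ Ω, ∫ t in Ioc (0:ℝ) 1, G t * v / (a + t * v - z) = 0 := by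
      intro z hz
      apply integral_undef
      intro hi
      apply hG
      have h3 : AEStronglyMeasurable (fun t : ℝ => (G t * v / (a + t * v - z)) * ((a + t * v - z) / v))
          (volume.restrict (Ioc (0:ℝ) 1)) :=
        hi.1.mul (by fun_prop)
      refine h3.congr ?_
      filter_upwards [ae_restrict_mem measurableSet_Ioc] with t ht
      have : a + t * v - z ≠ 0 := sub_ne_zero.2 (hs z hz t ⟨ht.1.le, ht.2⟩)
      rw [div_mul_div_cancel₀ this, mul_div_cancel_right₀ _ hv]
    refine ⟨(differentiableOn_const 0).congr h0, 0, ?_⟩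
    refine (MemLp.zero (p := 2) (μ := volume.restrict Ω) (ε := ℂ)).ae_eq ?_
    filter_upwards [ae_restrict_mem hΩo.measurableSet] with z hz
    simp [h0 z hz]
  have hGi : Integrable G (volume.restrict (Ioc (0:ℝ) 1)) := (integrable_norm_iff hG).1 h1
  have hdiff : DifferentiableOn ℂ (fun z => ∫ t in Ioc (0:ℝ) 1, G t * v / (a + t * v - z)) Ω := by
    apply hol_param hΩo
    · intro z hz
      have : AEStronglyMeasurable (fun t : ℝ => (G t) * (v / (a + t * v - z)))
          (volume.restrict (Ioc (0:ℝ) 1)) := hG.mul (Measurable.aestronglyMeasurable (by fun_prop))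
      simpa only [mul_div_assoc] using this
    · filter_upwards [ae_restrict_mem measurableSet_Ioc] with t ht
      intro z hz
      have : a + t * v - z ≠ 0 := sub_ne_zero.2 (hs z hz t ⟨ht.1.le, ht.2⟩)
      apply DifferentiableAt.differentiableWithinAt
      fun_prop (disch := assumption)
    · intro z hz
      obtain ⟨r, hr, hrb⟩ := seg_dist a v z (hs z hz)
      refine ⟨r, hr, fun t => ‖G t‖ * (‖v‖ / r), h1.mul_const _, ?_⟩
      filter_upwards [ae_restrict_mem measurableSet_Ioc] with t ht w hw
      have := hrb w hw t ⟨ht.1.le, ht.2⟩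
      rw [norm_div, norm_mul, mul_div_assoc]
      gcongr
  refine ⟨hdiff, -(∫ t in Ioc (0:ℝ) 1, G t * v), ?_⟩
  have hp : ∀ z ∈ Ω, z - p ≠ 0 := fun z hz h => by
    have := hΩ z hz; rw [h, norm_zero] at this; linarith
  apply memLp_two_of
  · apply ContinuousOn.aestronglyMeasurable _ hΩo.measurableSet
    apply hdiff.continuousOn.sub
    exact continuousOn_const.div (by fun_prop) hp
  · set M : ℝ := ‖a - p‖ + ‖v‖ with hMdef
    set G0 : ℝ → ℝ := fun t => ‖hG.mk G t‖ with hG0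
    have hae : ∀ᵐ t ∂(volume.restrict (Ioc (0:ℝ) 1)), ‖G t‖ = G0 t := by
      filter_upwards [hG.ae_eq_mk] with t ht
      simp only [hG0, ← ht]
    have hG0m : Measurable G0 := hG.stronglyMeasurable_mk.measurable.norm
    have hcore := core_bound a v p hv ε hε Ω hΩo.measurableSet hΩ G0 hG0m (fun t => norm_nonneg _)
      (h1.congr hae) (h2.congr (by filter_upwards [hae] with t ht; rw [ht]))
    have hpt : ∀ z ∈ Ω, ‖(∫ t in Ioc (0:ℝ) 1, G t * v / (a + t * v - z)) - -(∫ t in Ioc (0:ℝ) 1, G t * v) / (z - p)‖ₑ^2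
        ≤ ENNReal.ofReal (‖v‖ * M)^2 * (∫⁻ t in Ioc (0:ℝ) 1, ENNReal.ofReal (G0 t / (‖a + t * v - z‖ * ‖z - p‖)))^2 := by
      intro z hz
      rw [← mul_pow]
      gcongr
      have hi1 : Integrable (fun t : ℝ => G t * v / (a + t * v - z)) (volume.restrict (Ioc (0:ℝ) 1)) := by
        obtain ⟨r, hr, hrb⟩ := seg_dist a v z (hs z hz)
        have hm : AEStronglyMeasurable (fun t : ℝ => (G t) * (v / (a + t * v - z)))
          (volume.restrict (Ioc (0:ℝ) 1)) := hG.mul (Measurable.aestronglyMeasurable (by fun_prop))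
        simp only [← mul_div_assoc] at hm
        refine (h1.mul_const (‖v‖ / r)).mono' hm ?_
        filter_upwards [ae_restrict_mem measurableSet_Ioc] with t ht
        have := hrb z (Metric.mem_ball_self hr) t ⟨ht.1.le, ht.2⟩
        rw [norm_div, norm_mul, mul_div_assoc]
        gcongr
      have e1 : (∫ t in Ioc (0:ℝ) 1, G t * v / (a + t * v - z)) - -(∫ t in Ioc (0:ℝ) 1, G t * v) / (z - p)
          = ∫ t in Ioc (0:ℝ) 1, (G t * v / (a + t * v - z) + G t * v / (z - p)) := by
        rw [integral_add hi1 ((hGi.mul_const v).div_const _), integral_div]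
        ring
      rw [e1]
      refine (enorm_integral_le_lintegral_enorm _).trans ?_
      rw [← lintegral_const_mul _ (by fun_prop)]
      apply lintegral_mono_ae
      filter_upwards [hae, ae_restrict_mem measurableSet_Ioc] with t ht htm
      have hne : a + t * v - z ≠ 0 := sub_ne_zero.2 (hs z hz t ⟨htm.1.le, htm.2⟩)
      have hzp := hp z hz
      have e2 : G t * v / (a + t * v - z) + G t * v / (z - p)
          = G t * v * (a - p + t * v) / ((a + t * v - z) * (z - p)) := by
        rw [div_add_div _ _ hne hzp]; congr 1; ring
      rw [e2, ← ofReal_norm, ← ENNReal.ofReal_mul (by positivity), ← ht]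
      apply ENNReal.ofReal_le_ofReal
      rw [norm_div, norm_mul, norm_mul, norm_mul, ← mul_div_assoc]
      have hM : ‖a - p + t * v‖ ≤ M := by
        refine (norm_add_le _ _).trans ?_
        rw [norm_mul, Complex.norm_real, Real.norm_eq_abs, abs_of_pos htm.1]
        nlinarith [htm.2, norm_nonneg v]
      gcongr ?_ / _
      calc _ ≤ ‖G t‖ * ‖v‖ * M := by gcongr
        _ = _ := by ring
    calc _ ≤ _ := setLIntegral_mono' hΩo.measurableSet hpt
      _ = _ := lintegral_const_mul' _ _ (ENNReal.pow_ne_top ENNReal.ofReal_ne_top)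
      _ < ⊤ := ENNReal.mul_lt_top (ENNReal.pow_lt_top ENNReal.ofReal_lt_top) hcore

lemma mem_Delta {z : ℂ} : z ∈ SectorDelta ↔ |z.im| < z.re := by
  constructor
  · exact fun h => h.2
  · exact fun h => ⟨(abs_nonneg _).trans_lt h, h⟩

lemma mem_PiDelta {z : ℂ} : z ∈ SectorPiDelta ↔ |z.im| < Real.pi - z.re := by
  constructor
  · rintro ⟨w, hw, rfl⟩
    rw [mem_Delta] at hw
    simpa using hw
  · intro h
    refine ⟨(Real.pi : ℂ) - z, mem_Delta.2 (by simpa using h), by simp⟩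

lemma mem_D {z : ℂ} : z ∈ SquareD ↔ |z.im| < z.re ∧ |z.im| < Real.pi - z.re := by
  rw [← mem_Delta, ← mem_PiDelta]; rfl

lemma isOpen_Delta : IsOpen SectorDelta := by
  have : SectorDelta = {z : ℂ | |z.im| < z.re} := by ext z; exact mem_Delta
  rw [this]
  exact isOpen_lt (by fun_prop) (by fun_prop)

lemma isOpen_PiDelta : IsOpen SectorPiDelta := by
  have : SectorPiDelta = {z : ℂ | |z.im| < Real.pi - z.re} := by ext z; exact mem_PiDelta
  rw [this]
  exact isOpen_lt (by fun_prop) (by fun_prop)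

lemma isOpen_D : IsOpen SquareD := isOpen_Delta.inter isOpen_PiDelta

/-- vertical diagonal -/
def gam (t : ℝ) : ℂ := (((Real.pi / 2 : ℝ) : ℂ) - ((Real.pi / 2 : ℝ) : ℂ) * Complex.I) + t * (Real.pi * Complex.I)

lemma gam_re (t : ℝ) : (gam t).re = Real.pi / 2 := by simp [gam]
lemma gam_im (t : ℝ) : (gam t).im = Real.pi * (t - 1/2) := by simp [gam]; ring

lemma gam_mem {t : ℝ} (ht : t ∈ Ioo (0:ℝ) 1) : gam t ∈ SquareD := by
  rw [mem_D, gam_re, gam_im]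
  have hp := Real.pi_pos
  have : |Real.pi * (t - 1/2)| < Real.pi / 2 := by
    rw [abs_lt]; constructor <;> nlinarith [ht.1, ht.2]
  constructor <;> linarith

lemma ae_gam_ne (z : ℂ) : ∀ᵐ t ∂(volume.restrict (Ioc (0:ℝ) 1)), t ∈ Ioo (0:ℝ) 1 ∧ gam t ≠ z := by
  filter_upwards [ae_restrict_mem measurableSet_Ioc, ae_restrict_of_ae (Measure.ae_ne volume (1:ℝ)),
    ae_restrict_of_ae (Measure.ae_ne volume (z.im / Real.pi + 1/2))] with t h1 h2 h3
  refine ⟨⟨h1.1, lt_of_le_of_ne h1.2 h2⟩, ?_⟩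
  rintro rfl
  apply h3
  rw [gam_im]
  field_simp
  ring

lemma continuous_gam : Continuous gam := by unfold gam; fun_prop

lemma aesm_gam {H : ℂ → ℂ} (hH : DifferentiableOn ℂ H SquareD) :
    AEStronglyMeasurable (fun t => H (gam t)) (volume.restrict (Ioc (0:ℝ) 1)) := by
  rw [← restrict_Ioo_eq_restrict_Ioc]
  apply ContinuousOn.aestronglyMeasurable _ measurableSet_Ioo
  exact hH.continuousOn.comp continuous_gam.continuousOn (fun t ht => gam_mem ht)

lemma Q_hol {H : ℂ → ℂ} (hH : DifferentiableOn ℂ H SquareD)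
    (h1 : IntegrableOn (fun t => ‖H (gam t)‖) (Ioc (0:ℝ) 1)) :
    DifferentiableOn ℂ (fun z => ∫ t in Ioc (0:ℝ) 1, dslope H (gam t) z) SquareD := by
  apply hol_param isOpen_D
  · intro z hz
    have : AEStronglyMeasurable (fun t => (z - gam t)⁻¹ * (H z - H (gam t))) (volume.restrict (Ioc (0:ℝ) 1)) := by
      apply AEStronglyMeasurable.mul
      · have := continuous_gam.measurable
        exact Measurable.aestronglyMeasurable (by fun_prop)
      · exact aestronglyMeasurable_const.sub (aesm_gam hH)
    refine this.congr ?_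
    filter_upwards [ae_gam_ne z] with t ht
    rw [dslope_of_ne _ ht.2.symm, slope_def_module]; rfl
  · filter_upwards [ae_gam_ne 0] with t ht
    exact (Complex.differentiableOn_dslope (isOpen_D.mem_nhds (gam_mem ht.1))).2 hH
  · intro z hz
    obtain ⟨r0, hr0, hr0U⟩ := Metric.isOpen_iff.1 isOpen_D z hz
    set r := r0 / 3 with hr
    have hrp : 0 < r := by positivity
    have hsub : Metric.closedBall z (2 * r) ⊆ SquareD := fun x hx => hr0U (by
      rw [Metric.mem_closedBall] at hx; rw [Metric.mem_ball]; linarith)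
    obtain ⟨M, hM⟩ := (isCompact_closedBall z (2*r)).exists_bound_of_continuousOn (hH.continuousOn.mono hsub)
    obtain ⟨M', hM'⟩ := (isCompact_closedBall z (2*r)).exists_bound_of_continuousOn
      ((hH.deriv isOpen_D).continuousOn.mono hsub)
    have hz0 : z ∈ Metric.closedBall z (2 * r) := Metric.mem_closedBall_self (by positivity)
    have hM0 : 0 ≤ M := (norm_nonneg _).trans (hM z hz0)
    have hM0' : 0 ≤ M' := (norm_nonneg _).trans (hM' z hz0)
    refine ⟨r, hrp, fun t => M' + (M + ‖H (gam t)‖) / r, ?_, ?_⟩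
    · have hc : ∀ x : ℝ, Integrable (fun _ : ℝ => x) (volume.restrict (Ioc (0:ℝ) 1)) := fun x =>
        integrable_const x
      exact (hc M').add (((hc M).add h1).div_const r)
    · refine Filter.Eventually.of_forall ?_
      intro t w hw
      rw [Metric.mem_ball] at hw
      have hw2 : w ∈ Metric.closedBall z (2 * r) := by rw [Metric.mem_closedBall]; linarith
      by_cases ht : gam t ∈ Metric.closedBall z (2 * r)
      · have : ‖dslope H (gam t) w‖ ≤ M' := by
          by_cases hwt : w = gam t
          · rw [hwt, dslope_same]; exact hM' _ ht
          · rw [dslope_of_ne _ hwt, slope_def_module, norm_smul, norm_inv]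
            have := Convex.norm_image_sub_le_of_norm_deriv_le (f := H) (C := M')
              (fun x hx => hH.differentiableAt (isOpen_D.mem_nhds (hsub hx))) hM' (convex_closedBall z (2*r)) ht hw2
            have hpos : 0 < ‖w - gam t‖ := norm_pos_iff.2 (sub_ne_zero.2 hwt)
            rw [inv_mul_le_iff₀ hpos]
            linarith
        have h2 : 0 ≤ (M + ‖H (gam t)‖) / r := by positivity
        linarith
      · have hd : r ≤ ‖w - gam t‖ := by
          rw [Metric.mem_closedBall, not_le] at ht
          rw [← dist_eq_norm, dist_comm]
          linarith [dist_triangle (gam t) w z]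
        have hwt : w ≠ gam t := fun h => ht (h ▸ hw2)
        rw [dslope_of_ne _ hwt, slope_def_module, norm_smul, norm_inv]
        have : ‖w - gam t‖⁻¹ * ‖H w - H (gam t)‖ ≤ (M + ‖H (gam t)‖) / r := by
          rw [div_eq_inv_mul]
          gcongr
          exact (norm_sub_le _ _).trans (by gcongr; exact hM w hw2)
        linarith

lemma hasDerivAt_gam (t : ℝ) : HasDerivAt gam (Real.pi * Complex.I) t := by
  unfold gam
  have h := (((hasDerivAt_id t).ofReal_comp).mul_const ((Real.pi : ℂ) * Complex.I)).const_add
    (((Real.pi / 2 : ℝ) : ℂ) - ((Real.pi / 2 : ℝ) : ℂ) * Complex.I)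
  simpa using h

lemma gam_zero : gam 0 = ((Real.pi / 2 : ℝ) : ℂ) - ((Real.pi / 2 : ℝ) : ℂ) * Complex.I := by simp [gam]
lemma gam_one : gam 1 = ((Real.pi / 2 : ℝ) : ℂ) + ((Real.pi / 2 : ℝ) : ℂ) * Complex.I := by
  simp [gam]; ring

lemma J_left {z : ℂ} (hz : z.re < Real.pi / 2) :
    ∫ t in (0:ℝ)..1, (Real.pi * Complex.I) / (gam t - z) = Complex.log (gam 1 - z) - Complex.log (gam 0 - z) := by
  have hs : ∀ t, gam t - z ∈ Complex.slitPlane := fun t => Or.inl (by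
    rw [Complex.sub_re, gam_re]; linarith)
  apply intervalIntegral.integral_eq_sub_of_hasDerivAt (f := fun t => Complex.log (gam t - z))
  · intro t _
    exact ((hasDerivAt_gam t).sub_const z).clog_real (hs t)
  · apply Continuous.intervalIntegrable
    exact continuous_const.div (continuous_gam.sub continuous_const) (fun t => Complex.slitPlane_ne_zero (hs t))

lemma J_right {z : ℂ} (hz : Real.pi / 2 < z.re) :
    ∫ t in (0:ℝ)..1, (Real.pi * Complex.I) / (gam t - z) = Complex.log (z - gam 1) - Complex.log (z - gam 0) := by
  have hs : ∀ t, z - gam t ∈ Complex.slitPlane := fun t => Or.inl (by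
    rw [Complex.sub_re, gam_re]; linarith)
  apply intervalIntegral.integral_eq_sub_of_hasDerivAt (f := fun t => Complex.log (z - gam t))
  · intro t _
    have := ((hasDerivAt_gam t).const_sub z).clog_real (hs t)
    rwa [← neg_sub (gam t) z, neg_div_neg_eq] at this
  · apply Continuous.intervalIntegrable
    refine continuous_const.div (continuous_gam.sub continuous_const) (fun t => ?_)
    rw [← neg_sub]
    exact neg_ne_zero.2 (Complex.slitPlane_ne_zero (hs t))

lemma log_neg_pos {w : ℂ} (h : 0 < w.im) : Complex.log (-w) = Complex.log w - Real.pi * Complex.I := by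
  simp only [Complex.log, norm_neg, Complex.arg_neg_eq_arg_sub_pi_of_im_pos h]; push_cast; ring
lemma log_neg_neg {w : ℂ} (h : w.im < 0) : Complex.log (-w) = Complex.log w + Real.pi * Complex.I := by
  simp only [Complex.log, norm_neg, Complex.arg_neg_eq_arg_add_pi_of_im_neg h]; push_cast; ring

lemma D_im {z : ℂ} (hz : z ∈ SquareD) : 0 < (gam 1 - z).im ∧ (gam 0 - z).im < 0 := by
  rw [mem_D] at hz
  rw [Complex.sub_im, Complex.sub_im, gam_im, gam_im]
  have := abs_lt.1 hz.1
  have := abs_lt.1 hz.2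
  constructor <;> linarith

lemma J_right' {z : ℂ} (hD : z ∈ SquareD) (hz : Real.pi / 2 < z.re) :
    ∫ t in (0:ℝ)..1, (Real.pi * Complex.I) / (gam t - z) =
      Complex.log (gam 1 - z) - Complex.log (gam 0 - z) - 2 * Real.pi * Complex.I := by
  rw [J_right hz, ← neg_sub (gam 1), ← neg_sub (gam 0), log_neg_pos (D_im hD).1, log_neg_neg (D_im hD).2]
  ring

lemma L_hol : DifferentiableOn ℂ (fun z => Complex.log (gam 1 - z) - Complex.log (gam 0 - z)) SquareD := by
  intro z hz
  have h1 : gam 1 - z ∈ Complex.slitPlane := Or.inr (D_im hz).1.ne'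
  have h2 : gam 0 - z ∈ Complex.slitPlane := Or.inr (D_im hz).2.ne
  apply DifferentiableAt.differentiableWithinAt
  exact ((differentiableAt_const _).sub differentiableAt_id).clog h1 |>.sub
    (((differentiableAt_const _).sub differentiableAt_id).clog h2)

lemma gam_ne {z : ℂ} (hz : z.re ≠ Real.pi / 2) (t : ℝ) : gam t - z ≠ 0 := by
  intro h; apply hz; rw [← sub_eq_zero.1 h, gam_re]

lemma C_eq {H : ℂ → ℂ} (hH : DifferentiableOn ℂ H SquareD)
    (h1 : IntegrableOn (fun t => ‖H (gam t)‖) (Ioc (0:ℝ) 1)) {z : ℂ} (hz : z.re ≠ Real.pi / 2) :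
    ∫ t in (0:ℝ)..1, H (gam t) * (Real.pi * Complex.I) / (gam t - z) =
      (Real.pi * Complex.I) * (∫ t in Ioc (0:ℝ) 1, dslope H (gam t) z) +
      H z * ∫ t in (0:ℝ)..1, (Real.pi * Complex.I) / (gam t - z) := by
  have hcont : Continuous (fun t => (Real.pi * Complex.I) / (gam t - z)) :=
    continuous_const.div (continuous_gam.sub continuous_const) (gam_ne hz)
  have hHi : Integrable (fun t => H (gam t)) (volume.restrict (Ioc (0:ℝ) 1)) :=
    (integrable_norm_iff (aesm_gam hH)).1 h1
  have hI1 : IntervalIntegrable (fun t => H (gam t) * ((Real.pi * Complex.I) / (gam t - z))) volume 0 1 := by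
    apply IntervalIntegrable.mul_continuousOn
    · exact (intervalIntegrable_iff_integrableOn_Ioc_of_le zero_le_one).2 hHi
    · exact hcont.continuousOn
  have hI2 : IntervalIntegrable (fun t => H z * ((Real.pi * Complex.I) / (gam t - z))) volume 0 1 :=
    (hcont.intervalIntegrable 0 1).const_mul _
  have key : (Real.pi * Complex.I) * (∫ t in Ioc (0:ℝ) 1, dslope H (gam t) z) =
      ∫ t in (0:ℝ)..1, (H (gam t) * ((Real.pi * Complex.I) / (gam t - z)) - H z * ((Real.pi * Complex.I) / (gam t - z))) := by
    rw [← integral_const_mul, intervalIntegral.integral_of_le zero_le_one]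
    apply integral_congr_ae
    filter_upwards [ae_gam_ne z] with t ht
    have h0 := gam_ne hz t
    have h0' : z - gam t ≠ 0 := sub_ne_zero.2 ht.2.symm
    rw [dslope_of_ne _ ht.2.symm, slope_def_module, smul_eq_mul, ← neg_sub (gam t) z]
    field_simp
    ring
  rw [key, intervalIntegral.integral_sub hI1 hI2, intervalIntegral.integral_const_mul (H z)]
  simp only [mul_div_assoc]
  ring

lemma line_null : ∀ᵐ z : ℂ, z.re ≠ Real.pi / 2 := by
  have h : (volume : Measure (ℝ × ℝ)) ({Real.pi / 2} ×ˢ univ) = 0 := by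
    rw [Measure.volume_eq_prod, Measure.prod_prod]; simp
  have h2 := Complex.volume_preserving_equiv_real_prod.measure_preimage
    (s := ({Real.pi / 2} ×ˢ univ)) (by measurability)
  rw [h] at h2
  rw [ae_iff]
  refine measure_mono_null ?_ h2
  intro z hz
  simp at hz
  simp [Complex.measurableEquivRealProd, hz]

lemma split_B (p : ℂ) (ε : ℝ) (hε : 0 < ε) (hp : ∀ z ∈ SectorDelta ∪ SectorPiDelta, ε ≤ ‖z - p‖)
    (H : ℂ → ℂ) (hH : DifferentiableOn ℂ H SquareD) (hL : MemLp H 2 (volume.restrict SquareD))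
    (h1 : IntervalIntegrable (fun t => ‖H (gam t)‖) volume 0 1)
    (h2 : IntervalIntegrable (fun t => ‖H (gam t)‖ * logPlus ‖H (gam t)‖) volume 0 1) :
    ∃ (f₁ f₂ : ℂ → ℂ) (c : ℂ), DifferentiableOn ℂ f₁ SectorDelta ∧ DifferentiableOn ℂ f₂ SectorPiDelta ∧
      MemLp (fun z => f₁ z + c / (z - p)) 2 (volume.restrict SectorDelta) ∧
      MemLp (fun z => f₂ z - c / (z - p)) 2 (volume.restrict SectorPiDelta) ∧
      ∀ z ∈ SquareD, f₁ z + f₂ z = H z := by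
  classical
  have hpi := Real.pi_pos
  have hline : IsOpen {z : ℂ | z.re ≠ Real.pi / 2} := isOpen_ne_fun (by fun_prop) (by fun_prop)
  have h1' := (intervalIntegrable_iff_integrableOn_Ioc_of_le zero_le_one).1 h1
  have hseg := cauchy_seg (((Real.pi / 2 : ℝ) : ℂ) - ((Real.pi / 2 : ℝ) : ℂ) * Complex.I) (Real.pi * Complex.I) p
    (by simp) ε hε ((SectorDelta ∪ SectorPiDelta) ∩ {z : ℂ | z.re ≠ Real.pi / 2})
    ((isOpen_Delta.union isOpen_PiDelta).inter hline) (fun z hz => hp z hz.1)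
    (fun z hz t _ => by
      have := gam_ne hz.2 t
      rw [sub_ne_zero] at this; exact this) (fun t => H (gam t)) h1 h2
  set T : ℂ := 2 * Real.pi * Complex.I with hT
  have hT0 : T ≠ 0 := by simp [hT]
  set C : ℂ → ℂ := fun z => ∫ t in (0:ℝ)..1, H (gam t) * (Real.pi * Complex.I) / (gam t - z) with hC
  obtain ⟨hd, c', hc'⟩ := hseg
  change DifferentiableOn ℂ C _ at hd
  change MemLp (fun z => C z - c' / (z - p)) 2 _ at hc'
  set S : ℂ → ℂ := fun z => T⁻¹ * ((Real.pi * Complex.I) * (∫ t in Ioc (0:ℝ) 1, dslope H (gam t) z) +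
    H z * (Complex.log (gam 1 - z) - Complex.log (gam 0 - z))) with hS
  have hSd : DifferentiableOn ℂ S SquareD :=
    (((Q_hol hH h1').const_mul _).add (hH.mul L_hol)).const_mul _
  have hSl : ∀ z ∈ SquareD, z.re < Real.pi / 2 → S z = T⁻¹ * C z := by
    intro z hz hl
    simp only [hS, hC]
    rw [C_eq hH h1' hl.ne, J_left hl]
  have hSr : ∀ z ∈ SquareD, Real.pi / 2 < z.re → S z = H z + T⁻¹ * C z := by
    intro z hz hl
    simp only [hS, hC]
    rw [C_eq hH h1' hl.ne', J_right' hz hl]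
    simp only [← hT]
    field_simp
    ring
  set f₁ : ℂ → ℂ := fun z => if z ∈ SquareD then H z - S z else -(T⁻¹ * C z) with hf₁
  set f₂ : ℂ → ℂ := fun z => if z ∈ SquareD then S z else T⁻¹ * C z with hf₂
  have h1D : ∀ z ∈ SectorDelta, z ∉ SquareD → Real.pi / 2 < z.re := by
    intro z hz hD
    by_contra hlt
    rw [mem_Delta] at hz
    exact hD (mem_D.2 ⟨hz, by linarith⟩)
  have h2D : ∀ z ∈ SectorPiDelta, z ∉ SquareD → z.re < Real.pi / 2 := by
    intro z hz hD
    by_contra hlt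
    rw [mem_PiDelta] at hz
    exact hD (mem_D.2 ⟨by linarith, hz⟩)
  have hf₁r : ∀ z ∈ SectorDelta, Real.pi / 2 < z.re → f₁ z = -(T⁻¹ * C z) := by
    intro z _ hr
    simp only [hf₁]
    split_ifs with h
    · rw [hSr z h hr]; ring
    · rfl
  have hf₂l : ∀ z ∈ SectorPiDelta, z.re < Real.pi / 2 → f₂ z = T⁻¹ * C z := by
    intro z _ hr
    simp only [hf₂]
    split_ifs with h
    · rw [hSl z h hr]
    · rfl
  have hnull := line_null
  have hDm := isOpen_D.measurableSet
  have hind : ∀ A : Set ℂ, MeasurableSet A → ∀ Ω : Set ℂ,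
      MemLp ((SquareD ∩ A).indicator H) 2 (volume.restrict Ω) := by
    intro A hA Ω
    have : MemLp ((SquareD ∩ A).indicator H) 2 volume := by
      rw [memLp_indicator_iff_restrict (hDm.inter hA)]
      exact hL.mono_measure (Measure.restrict_mono inter_subset_left le_rfl)
    exact this.restrict _
  have hrestr : ∀ Ω ⊆ SectorDelta ∪ SectorPiDelta, MemLp (fun z => C z - c' / (z - p)) 2 (volume.restrict Ω) := by
    intro Ω hΩ
    refine hc'.mono_measure ?_
    have e : volume.restrict (Ω ∩ {z : ℂ | z.re ≠ Real.pi / 2}) = volume.restrict Ω := by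
      apply Measure.restrict_congr_set
      filter_upwards [hnull] with z hz
      apply propext
      exact ⟨fun h => h.1, fun h => ⟨h, hz⟩⟩
    rw [← e]
    exact Measure.restrict_mono (inter_subset_inter_left _ hΩ) le_rfl
  refine ⟨f₁, f₂, T⁻¹ * c', ?_, ?_, ?_, ?_, ?_⟩
  · intro z hz
    apply DifferentiableAt.differentiableWithinAt
    by_cases hD : z ∈ SquareD
    · have : DifferentiableAt ℂ (fun z => H z - S z) z :=
        (hH.sub hSd).differentiableAt (isOpen_D.mem_nhds hD)
      refine this.congr_of_eventuallyEq ?_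
      filter_upwards [isOpen_D.mem_nhds hD] with w hw
      simp only [hf₁, if_pos hw]
    · have hr := h1D z hz hD
      have : DifferentiableAt ℂ (fun z => -(T⁻¹ * C z)) z :=
        ((hd.differentiableAt (((isOpen_Delta.union isOpen_PiDelta).inter hline).mem_nhds
          ⟨Or.inl hz, hr.ne'⟩)).const_mul _).neg
      refine this.congr_of_eventuallyEq ?_
      filter_upwards [isOpen_Delta.mem_nhds hz, (isOpen_lt continuous_const Complex.continuous_re).mem_nhds hr] with w hw hwr
      exact hf₁r w hw hwr
  · intro z hz
    apply DifferentiableAt.differentiableWithinAt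
    by_cases hD : z ∈ SquareD
    · have : DifferentiableAt ℂ S z := hSd.differentiableAt (isOpen_D.mem_nhds hD)
      refine this.congr_of_eventuallyEq ?_
      filter_upwards [isOpen_D.mem_nhds hD] with w hw
      simp only [hf₂, if_pos hw]
    · have hr := h2D z hz hD
      have : DifferentiableAt ℂ (fun z => T⁻¹ * C z) z :=
        ((hd.differentiableAt (((isOpen_Delta.union isOpen_PiDelta).inter hline).mem_nhds
          ⟨Or.inr hz, hr.ne⟩)).const_mul _)
      refine this.congr_of_eventuallyEq ?_
      filter_upwards [isOpen_PiDelta.mem_nhds hz, (isOpen_lt Complex.continuous_re continuous_const).mem_nhds hr] with w hw hwr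
      exact hf₂l w hw hwr
  · have hm := ((hrestr SectorDelta subset_union_left).const_mul (-T⁻¹)).add
      (hind {z | z.re < Real.pi / 2} (measurableSet_lt (by fun_prop) (by fun_prop)) SectorDelta)
    refine hm.ae_eq ?_
    filter_upwards [ae_restrict_mem isOpen_Delta.measurableSet, ae_restrict_of_ae hnull] with z hz hne
    simp only [Pi.add_apply]
    rcases lt_or_gt_of_ne hne with hl | hr
    · have hD : z ∈ SquareD := by by_contra h; exact absurd (h1D z hz h) (by linarith)
      rw [indicator_of_mem (show z ∈ SquareD ∩ {z | z.re < Real.pi / 2} from ⟨hD, hl⟩)]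
      simp only [hf₁, if_pos hD, hSl z hD hl]
      ring
    · rw [indicator_of_notMem (fun h => absurd h.2 (not_lt.2 hr.le)), hf₁r z hz hr]
      ring
  · have hm := ((hrestr SectorPiDelta subset_union_right).const_mul (T⁻¹)).add
      (hind {z | Real.pi / 2 < z.re} (measurableSet_lt (by fun_prop) (by fun_prop)) SectorPiDelta)
    refine hm.ae_eq ?_
    filter_upwards [ae_restrict_mem isOpen_PiDelta.measurableSet, ae_restrict_of_ae hnull] with z hz hne
    simp only [Pi.add_apply]
    rcases lt_or_gt_of_ne hne with hl | hr
    · rw [indicator_of_notMem (fun h => absurd h.2 (not_lt.2 hl.le)), hf₂l z hz hl]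
      ring
    · have hD : z ∈ SquareD := by by_contra h; exact absurd (h2D z hz h) (by linarith)
      rw [indicator_of_mem (show z ∈ SquareD ∩ {z | Real.pi / 2 < z.re} from ⟨hD, hr⟩)]
      simp only [hf₂, if_pos hD, hSr z hD hr]
      ring
  · intro z hz
    simp only [hf₁, hf₂, if_pos hz]
    ring

lemma circle_mean {h : ℂ → ℂ} {c : ℂ} {R r : ℝ} (hh : DifferentiableOn ℂ h (Metric.ball c R)) (hr : 0 < r)
    (hrR : r < R) :
    ENNReal.ofReal (2 * Real.pi) * ‖h c‖ₑ^2 ≤ ∫⁻ θ in Ioo (-Real.pi) Real.pi, ‖h (circleMap c r θ)‖ₑ^2 := by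
  have hd : DiffContOnCl ℂ (fun z => h z ^ 2) (Metric.ball c |r|) := by
    apply DifferentiableOn.diffContOnCl
    rw [abs_of_pos hr, closure_ball _ hr.ne']
    exact (hh.mono (Metric.closedBall_subset_ball hrR)).pow 2
  have h1 := hd.circleAverage
  rw [Real.circleAverage_def] at h1
  have hper : Function.Periodic (fun θ => h (circleMap c r θ) ^ 2) (2 * Real.pi) := by
    intro θ; simp only [periodic_circleMap c r θ]
  have h2 := hper.intervalIntegral_add_eq 0 (-Real.pi)
  rw [zero_add, show -Real.pi + 2 * Real.pi = Real.pi by ring] at h2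
  rw [h2] at h1
  have h3 : ((2 * Real.pi : ℝ) : ℂ) * h c ^ 2 = ∫ θ in (-Real.pi)..Real.pi, h (circleMap c r θ) ^ 2 := by
    rw [← h1, Complex.real_smul, ← mul_assoc, ← Complex.ofReal_mul, mul_inv_cancel₀ (by positivity)]
    simp
  have h4 : ENNReal.ofReal (2 * Real.pi) * ‖h c‖ₑ^2 = ‖((2 * Real.pi : ℝ) : ℂ) * h c ^ 2‖ₑ := by
    rw [enorm_mul, enorm_pow, ← ofReal_norm ((2 * Real.pi : ℝ) : ℂ), Complex.norm_real, Real.norm_eq_abs,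
      abs_of_pos (by positivity)]
  rw [h4, h3, intervalIntegral.integral_of_le (by linarith [Real.pi_pos])]
  refine (enorm_integral_le_lintegral_enorm _).trans ?_
  rw [← restrict_Ioo_eq_restrict_Ioc]
  simp only [enorm_pow]
  exact le_rfl

lemma submean {h : ℂ → ℂ} {c : ℂ} {R : ℝ} (hR : 0 < R) (hh : DifferentiableOn ℂ h (Metric.ball c R)) :
    ENNReal.ofReal (R^2 / 4) * (ENNReal.ofReal (2 * Real.pi) * ‖h c‖ₑ^2) ≤ ∫⁻ z in Metric.ball c R, ‖h z‖ₑ^2 := by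
  classical
  set g : ℂ → ENNReal := (Metric.ball c R).indicator (fun z => ‖h z‖ₑ^2) with hg
  have hgm : Measurable g := by
    rw [hg, ← piecewise_eq_indicator]
    apply ContinuousOn.measurable_piecewise _ continuousOn_const measurableSet_ball
    exact (ENNReal.continuous_pow 2).comp_continuousOn hh.continuousOn.enorm
  rw [← lintegral_indicator measurableSet_ball, ← hg, ← lintegral_add_left_eq_self g c,
    ← Complex.lintegral_comp_polarCoord_symm, polarCoord_target, Measure.volume_eq_prod, ← Measure.prod_restrict]
  have hcm : ∀ q : ℝ × ℝ, c + Complex.polarCoord.symm q = circleMap c q.1 q.2 := by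
    intro q
    rw [Complex.polarCoord_symm_apply, circleMap, Complex.exp_mul_I, Complex.ofReal_cos, Complex.ofReal_sin]
  simp only [hcm, smul_eq_mul]
  rw [lintegral_prod]
  swap
  · apply Measurable.aemeasurable
    have : Measurable (fun q : ℝ × ℝ => circleMap c q.1 q.2) := by unfold circleMap; fun_prop
    fun_prop
  calc ENNReal.ofReal (R^2 / 4) * (ENNReal.ofReal (2 * Real.pi) * ‖h c‖ₑ^2)
      = ∫⁻ r in Ioo (R/2) R, ENNReal.ofReal (R/2) * (ENNReal.ofReal (2 * Real.pi) * ‖h c‖ₑ^2) := by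
        rw [setLIntegral_const, Real.volume_Ioo, mul_right_comm, ← ENNReal.ofReal_mul (by positivity)]
        congr 2; ring
    _ ≤ ∫⁻ r in Ioo (R/2) R, ∫⁻ θ in Ioo (-Real.pi) Real.pi, ENNReal.ofReal r * g (circleMap c r θ) := by
        apply setLIntegral_mono' measurableSet_Ioo
        intro r hr
        have hr0 : 0 < r := by linarith [hr.1]
        have hm : Measurable (fun θ => circleMap c r θ) := by unfold circleMap; fun_prop
        rw [lintegral_const_mul _ (by fun_prop)]
        refine mul_le_mul' (ENNReal.ofReal_le_ofReal hr.1.le) ?_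
        refine (circle_mean hh hr0 hr.2).trans (le_of_eq ?_)
        congr 1; ext θ
        rw [hg, indicator_of_mem]
        rw [Metric.mem_ball, dist_eq_norm, circleMap_sub_center, norm_circleMap_zero, abs_of_pos hr0]
        exact hr.2
    _ ≤ _ := by
        apply lintegral_mono_set
        intro r hr
        have : 0 < r := by linarith [hr.1]
        exact this

lemma gam_bdd (h : ℂ → ℂ) (hh : DifferentiableOn ℂ h SquareD)
    (hw : ∫⁻ z in SquareD, ENNReal.ofReal (‖h z‖ ^ 2 / (‖z - gam 1‖ ^ 2 * ‖z - gam 0‖ ^ 2)) < ⊤) :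
    ∃ B : ℝ, ∀ t ∈ Ioo (0:ℝ) 1, ‖h (gam t)‖ ≤ B := by
  have hpi := Real.pi_pos
  set W := ∫⁻ z in SquareD, ENNReal.ofReal (‖h z‖ ^ 2 / (‖z - gam 1‖ ^ 2 * ‖z - gam 0‖ ^ 2)) with hW
  have hdist : ∀ s t : ℝ, ‖gam t - gam s‖ = Real.pi * |t - s| := by
    intro s t
    have : gam t - gam s = ((Real.pi * (t - s) : ℝ) : ℂ) * Complex.I := by
      simp only [gam]; push_cast; ring
    rw [this, norm_mul, Complex.norm_I, mul_one, Complex.norm_real, Real.norm_eq_abs, abs_mul, abs_of_pos hpi]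
  have key : ∀ t ∈ Ioo (0:ℝ) 1, ‖h (gam t)‖ₑ^2 ≤ ENNReal.ofReal (72 * Real.pi) * W := by
    intro t ht
    set ρ := Real.pi * min t (1 - t) with hρ
    have hρ0 : 0 < ρ := mul_pos hpi (lt_min ht.1 (by linarith [ht.2]))
    have hρ1 : ρ ≤ Real.pi * t := mul_le_mul_of_nonneg_left (min_le_left _ _) hpi.le
    have hρ2 : ρ ≤ Real.pi * (1 - t) := mul_le_mul_of_nonneg_left (min_le_right _ _) hpi.le
    have hsub : Metric.ball (gam t) (ρ/2) ⊆ SquareD := by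
      intro z hz
      rw [Metric.mem_ball, dist_eq_norm] at hz
      have hre := (Complex.abs_re_le_norm (z - gam t)).trans_lt hz
      have him := (Complex.abs_im_le_norm (z - gam t)).trans_lt hz
      rw [Complex.sub_re, gam_re, abs_lt] at hre
      rw [Complex.sub_im, gam_im, abs_lt] at him
      rw [mem_D, abs_lt, abs_lt]
      refine ⟨⟨?_, ?_⟩, ?_, ?_⟩ <;> nlinarith [hre.1, hre.2, him.1, him.2]
    have hpt : ∀ z ∈ Metric.ball (gam t) (ρ/2), ‖h z‖ₑ^2 ≤ ENNReal.ofReal (9 * Real.pi^2 * ρ^2) *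
        ENNReal.ofReal (‖h z‖ ^ 2 / (‖z - gam 1‖ ^ 2 * ‖z - gam 0‖ ^ 2)) := by
      intro z hz
      have hzD := D_im (hsub hz)
      rw [Metric.mem_ball, dist_eq_norm] at hz
      have n1 : 0 < ‖z - gam 1‖ := by
        rw [norm_pos_iff]; intro h0
        rw [← neg_sub, h0] at hzD; simp at hzD
      have n0 : 0 < ‖z - gam 0‖ := by
        rw [norm_pos_iff]; intro h0
        rw [← neg_sub z (gam 0), h0] at hzD; simp at hzD
      have t1 : ‖z - gam 1‖ ≤ ρ/2 + Real.pi * (1 - t) := by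
        have := norm_add_le (z - gam t) (gam t - gam 1)
        rw [sub_add_sub_cancel, hdist, abs_sub_comm, abs_of_pos (by linarith [ht.2])] at this
        linarith
      have t0 : ‖z - gam 0‖ ≤ ρ/2 + Real.pi * t := by
        have := norm_add_le (z - gam t) (gam t - gam 0)
        rw [sub_add_sub_cancel, hdist, sub_zero, abs_of_pos ht.1] at this
        linarith
      have hprod : ‖z - gam 1‖ * ‖z - gam 0‖ ≤ 3 * Real.pi * ρ := by
        rcases le_total t (1 - t) with hm | hm
        · have : ρ = Real.pi * t := by rw [hρ, min_eq_left hm]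
          calc ‖z - gam 1‖ * ‖z - gam 0‖ ≤ (2 * Real.pi) * (3/2 * ρ) := by
                gcongr <;> nlinarith [ht.1, ht.2]
            _ = _ := by ring
        · have : ρ = Real.pi * (1 - t) := by rw [hρ, min_eq_right hm]
          calc ‖z - gam 1‖ * ‖z - gam 0‖ ≤ (3/2 * ρ) * (2 * Real.pi) := by
                gcongr <;> nlinarith [ht.1, ht.2]
            _ = _ := by ring
      rw [← ofReal_sq_norm, ← ENNReal.ofReal_mul (by positivity)]
      apply ENNReal.ofReal_le_ofReal
      rw [mul_div_assoc', le_div_iff₀ (by positivity)]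
      calc ‖h z‖^2 * (‖z - gam 1‖ ^ 2 * ‖z - gam 0‖ ^ 2) = (‖z - gam 1‖ * ‖z - gam 0‖)^2 * ‖h z‖^2 := by ring
        _ ≤ (3 * Real.pi * ρ)^2 * ‖h z‖^2 := by gcongr
        _ = _ := by ring
    have hsm := submean (by positivity : 0 < ρ/2) (hh.mono hsub)
    have hle : ENNReal.ofReal (ρ^2 * Real.pi / 8) * ‖h (gam t)‖ₑ^2 ≤
        ENNReal.ofReal (ρ^2 * Real.pi / 8) * (ENNReal.ofReal (72 * Real.pi) * W) := by
      calc _ = ENNReal.ofReal ((ρ/2)^2 / 4) * (ENNReal.ofReal (2 * Real.pi) * ‖h (gam t)‖ₑ^2) := by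
            rw [← mul_assoc, ← ENNReal.ofReal_mul (by positivity)]; congr 2; ring
        _ ≤ _ := hsm
        _ ≤ _ := setLIntegral_mono' measurableSet_ball hpt
        _ = _ := lintegral_const_mul' _ _ ENNReal.ofReal_ne_top
        _ ≤ ENNReal.ofReal (9 * Real.pi^2 * ρ^2) * W := mul_le_mul' le_rfl (lintegral_mono_set hsub)
        _ = _ := by rw [← mul_assoc, ← ENNReal.ofReal_mul (by positivity)]; congr 2; ring
    exact (ENNReal.mul_le_mul_iff_right (by
      rw [Ne, ENNReal.ofReal_eq_zero, not_le]; positivity) ENNReal.ofReal_ne_top).1 hle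
  refine ⟨Real.sqrt (ENNReal.ofReal (72 * Real.pi) * W).toReal, fun t ht => ?_⟩
  apply Real.le_sqrt_of_sq_le
  have := ENNReal.toReal_mono (ENNReal.mul_lt_top ENNReal.ofReal_lt_top hw).ne (key t ht)
  simpa using this

lemma gam_int {H : ℂ → ℂ} (hH : DifferentiableOn ℂ H SquareD) {B : ℝ}
    (hB : ∀ t ∈ Ioo (0:ℝ) 1, ‖H (gam t)‖ ≤ B) :
    IntervalIntegrable (fun t => ‖H (gam t)‖) volume 0 1 ∧
    IntervalIntegrable (fun t => ‖H (gam t)‖ * logPlus ‖H (gam t)‖) volume 0 1 := by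
  rw [intervalIntegrable_iff_integrableOn_Ioc_of_le zero_le_one,
    intervalIntegrable_iff_integrableOn_Ioc_of_le zero_le_one]
  have hm := (aesm_gam hH).norm
  have hc : ∀ x : ℝ, Integrable (fun _ : ℝ => x) (volume.restrict (Ioc (0:ℝ) 1)) := fun x =>
        integrable_const x
  have hlp : Measurable logPlus := by unfold logPlus; fun_prop
  constructor
  · refine (hc B).mono' hm ?_
    filter_upwards [ae_gam_ne 0] with t ht
    rw [norm_norm]; exact hB t ht.1
  · refine (hc (B * logPlus B)).mono' (hm.mul (hlp.comp_aemeasurable hm.aemeasurable).aestronglyMeasurable) ?_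
    filter_upwards [ae_gam_ne 0] with t ht
    have h1 := hB t ht.1
    have h0 : 0 ≤ logPlus ‖H (gam t)‖ := Real.log_nonneg (le_max_right _ _)
    rw [norm_mul, norm_norm, Real.norm_eq_abs, abs_of_nonneg h0]
    have h2 : logPlus ‖H (gam t)‖ ≤ logPlus B := by
      unfold logPlus; apply Real.log_le_log (by positivity); gcongr
    have hB0 : 0 ≤ B := (norm_nonneg _).trans h1
    gcongr

lemma p_dist {z : ℂ} (hz : z ∈ SectorDelta ∪ SectorPiDelta) :
    Real.pi / 4 ≤ ‖z - (((Real.pi / 2 : ℝ) : ℂ) + ((Real.pi : ℝ) : ℂ) * Complex.I)‖ := by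
  have h1 := Complex.abs_re_le_norm (z - (((Real.pi / 2 : ℝ) : ℂ) + ((Real.pi : ℝ) : ℂ) * Complex.I))
  have h2 := Complex.abs_im_le_norm (z - (((Real.pi / 2 : ℝ) : ℂ) + ((Real.pi : ℝ) : ℂ) * Complex.I))
  simp only [Complex.sub_re, Complex.add_re, Complex.mul_re, Complex.ofReal_re, Complex.ofReal_im, Complex.I_re,
    Complex.I_im, Complex.sub_im, Complex.add_im, Complex.mul_im] at h1 h2
  have h1 := abs_le.1 h1
  have h2 := abs_le.1 h2
  rcases hz with hz | hz
  · have := abs_lt.1 (mem_Delta.1 hz)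
    linarith [h1.1, h1.2, h2.1, h2.2, this.1, this.2]
  · have := abs_lt.1 (mem_PiDelta.1 hz)
    linarith [h1.1, h1.2, h2.1, h2.2, this.1, this.2]

lemma D_weight (h : ℂ → ℂ) (hh : DifferentiableOn ℂ h SquareD)
    (hw : ∫⁻ z in SquareD, ENNReal.ofReal (‖h z‖ ^ 2 / (‖z - gam 1‖ ^ 2 * ‖z - gam 0‖ ^ 2)) < ⊤) :
    MemLp h 2 (volume.restrict SquareD) := by
  have hpi := Real.pi_pos
  apply memLp_two_of (hh.continuousOn.aestronglyMeasurable isOpen_D.measurableSet)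
  have hn : ∀ z ∈ SquareD, ∀ w : ℂ, w.re = Real.pi / 2 → |w.im| ≤ Real.pi / 2 → ‖z - w‖ ≤ 2 * Real.pi := by
    intro z hz w h1 h2
    refine (Complex.norm_le_abs_re_add_abs_im _).trans ?_
    have a1 := abs_lt.1 (mem_D.1 hz).1
    have a2 := abs_lt.1 (mem_D.1 hz).2
    have a3 := abs_le.1 h2
    have b1 : |(z - w).re| ≤ Real.pi := by
      rw [Complex.sub_re, h1, abs_le]; constructor <;> linarith [a1.1, a1.2, a2.1, a2.2]
    have b2 : |(z - w).im| ≤ Real.pi := by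
      rw [Complex.sub_im, abs_le]; constructor <;> linarith [a1.1, a1.2, a2.1, a2.2, a3.1, a3.2]
    linarith
  calc ∫⁻ z in SquareD, ‖h z‖ₑ^2 ≤ ∫⁻ z in SquareD, ENNReal.ofReal ((2 * Real.pi)^2 * (2 * Real.pi)^2) *
        ENNReal.ofReal (‖h z‖ ^ 2 / (‖z - gam 1‖ ^ 2 * ‖z - gam 0‖ ^ 2)) := by
        apply setLIntegral_mono' isOpen_D.measurableSet
        intro z hz
        have hzD := D_im hz
        have n1 : 0 < ‖z - gam 1‖ := by
          rw [norm_pos_iff]; intro h0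
          rw [← neg_sub, h0] at hzD; simp at hzD
        have n0 : 0 < ‖z - gam 0‖ := by
          rw [norm_pos_iff]; intro h0
          rw [← neg_sub z (gam 0), h0] at hzD; simp at hzD
        have m1 := hn z hz (gam 1) (gam_re _) (by rw [gam_im, abs_le]; constructor <;> linarith)
        have m0 := hn z hz (gam 0) (gam_re _) (by rw [gam_im, abs_le]; constructor <;> linarith)
        rw [← ofReal_sq_norm, ← ENNReal.ofReal_mul (by positivity)]
        apply ENNReal.ofReal_le_ofReal
        rw [mul_div_assoc', le_div_iff₀ (by positivity), mul_comm]
        gcongr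
    _ = _ := lintegral_const_mul' _ _ ENNReal.ofReal_ne_top
    _ < ⊤ := ENNReal.mul_lt_top ENNReal.ofReal_lt_top hw

lemma sideDir_ne (k : Fin 4) : sideDir k ≠ 0 := by
  have hpi := Real.pi_pos
  intro h
  have h1 := congrArg Complex.re h
  fin_cases k <;> simp [sideDir] at h1 <;> linarith

lemma side_Delta {z : ℂ} (hz : z ∈ SectorDelta) {k : Fin 4} (hk : k = 0 ∨ k = 3) (t : ℝ) :
    sideStart k + t * sideDir k ≠ z := by
  rintro rfl
  have h := abs_lt.1 (mem_Delta.1 hz)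
  rcases hk with rfl | rfl <;> simp [sideStart, sideDir] at h <;> linarith [h.1, h.2]

lemma side_PiDelta {z : ℂ} (hz : z ∈ SectorPiDelta) {k : Fin 4} (hk : k = 1 ∨ k = 2) (t : ℝ) :
    sideStart k + t * sideDir k ≠ z := by
  rintro rfl
  have h := abs_lt.1 (mem_PiDelta.1 hz)
  rcases hk with rfl | rfl <;> simp [sideStart, sideDir] at h <;> linarith [h.1, h.2]

lemma memA2_of {Ω : Set ℂ} {f : ℂ → ℂ} (hd : DifferentiableOn ℂ f Ω)
    (hf : MemLp f 2 (volume.restrict Ω)) : MemA2 Ω f := by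
  refine ⟨hd, ?_⟩
  simp only [ofReal_sq_norm]
  exact lint_of_memLp_two hf

lemma memLp_of_memA2 {Ω : Set ℂ} (hΩ : IsOpen Ω) {f : ℂ → ℂ} (h : MemA2 Ω f) :
    MemLp f 2 (volume.restrict Ω) := by
  apply memLp_two_of (h.1.continuousOn.aestronglyMeasurable hΩ.measurableSet)
  have := h.2
  simpa only [ofReal_sq_norm] using this

lemma volume_D_lt : volume SquareD < ⊤ := by
  refine (measure_mono (t := Metric.ball 0 (2 * Real.pi)) ?_).trans_lt measure_ball_lt_top
  intro z hz
  have a1 := mem_D.1 hz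
  have hpi := Real.pi_pos
  rw [Metric.mem_ball, dist_zero_right]
  refine (Complex.norm_le_abs_re_add_abs_im z).trans_lt ?_
  rw [abs_of_pos ((abs_nonneg _).trans_lt a1.1)]
  linarith [a1.1, a1.2, abs_nonneg z.im]

/-- If `f = f₀ + h` on `D` where `f₀` is the Cauchy integral of an `L log⁺ L` boundary
function on `∂D` and `h` is holomorphic on `D` with
`∫_D |h|² |z−z₀|⁻²|z−z₁|⁻² dA < ∞`, then `f ∈ A²(Δ) + A²(π − Δ)`;
moreover `A²(Δ) + A²(π − Δ) ⊆ A²(D)`. -/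
theorem sum_criterion_and_sum_subset_bergman
    (z₀ z₁ : ℂ) (hz₀ : z₀ = ((Real.pi / 2 : ℝ) : ℂ) + ((Real.pi / 2 : ℝ) : ℂ) * Complex.I)
    (hz₁ : z₁ = ((Real.pi / 2 : ℝ) : ℂ) - ((Real.pi / 2 : ℝ) : ℂ) * Complex.I) :
    (∀ f g h : ℂ → ℂ,
        BoundaryIntegrable g → BoundaryLlogL g →
        DifferentiableOn ℂ h SquareD →
        (∫⁻ z in SquareD,
            ENNReal.ofReal (‖h z‖ ^ 2 / (‖z - z₀‖ ^ 2 * ‖z - z₁‖ ^ 2)) < ⊤) →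
        (∀ z ∈ SquareD, f z = cauchyD g z + h z) →
        ∃ f₁ f₂ : ℂ → ℂ, MemA2 SectorDelta f₁ ∧ MemA2 SectorPiDelta f₂ ∧
          ∀ z ∈ SquareD, f z = f₁ z + f₂ z) ∧
    (∀ f₁ f₂ : ℂ → ℂ, MemA2 SectorDelta f₁ → MemA2 SectorPiDelta f₂ →
        MemA2 SquareD (fun z => f₁ z + f₂ z)) := by
  have hsub1 : SquareD ⊆ SectorDelta := inter_subset_left
  have hsub2 : SquareD ⊆ SectorPiDelta := inter_subset_right
  constructor
  · intro f g h hg1 hg2 hh hw hf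
    rw [hz₀, hz₁, ← gam_zero, ← gam_one] at hw
    have hpi := Real.pi_pos
    have hε : 0 < Real.pi / 4 := by positivity
    obtain ⟨p, hp⟩ : ∃ p : ℂ, ∀ z ∈ SectorDelta ∪ SectorPiDelta, Real.pi / 4 ≤ ‖z - p‖ := ⟨_, fun z => p_dist⟩
    have hpne : ∀ z ∈ SectorDelta ∪ SectorPiDelta, z - p ≠ 0 := fun z hz =>
      norm_pos_iff.1 (hε.trans_le (hp z hz))
    have hpd : ∀ c : ℂ, ∀ Ω ⊆ SectorDelta ∪ SectorPiDelta, DifferentiableOn ℂ (fun z => c / (z - p)) Ω := by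
      intro c Ω hΩ
      exact (differentiableOn_const c).div (differentiableOn_id.sub (differentiableOn_const p))
        fun z hz => hpne z (hΩ hz)
    set F : Fin 4 → ℂ → ℂ := fun k z =>
      ∫ t in (0:ℝ)..1, g (sidePath k t) * sideDir k / (sidePath k t - z) with hF
    have seg1 : ∀ k : Fin 4, (k = 0 ∨ k = 3) → DifferentiableOn ℂ (F k) SectorDelta ∧ ∃ c : ℂ,
        MemLp (fun z => F k z - c / (z - p)) 2 (volume.restrict SectorDelta) := fun k hk =>
      cauchy_seg (sideStart k) (sideDir k) p (sideDir_ne k) _ hε _ isOpen_Delta (fun z hz => hp z (Or.inl hz))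
        (fun z hz t _ => side_Delta hz hk t) (fun t => g (sidePath k t)) (hg1 k) (hg2 k)
    have seg2 : ∀ k : Fin 4, (k = 1 ∨ k = 2) → DifferentiableOn ℂ (F k) SectorPiDelta ∧ ∃ c : ℂ,
        MemLp (fun z => F k z - c / (z - p)) 2 (volume.restrict SectorPiDelta) := fun k hk =>
      cauchy_seg (sideStart k) (sideDir k) p (sideDir_ne k) _ hε _ isOpen_PiDelta (fun z hz => hp z (Or.inr hz))
        (fun z hz t _ => side_PiDelta hz hk t) (fun t => g (sidePath k t)) (hg1 k) (hg2 k)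
    obtain ⟨d0, c0, m0⟩ := seg1 0 (Or.inl rfl)
    obtain ⟨d3, c3, m3⟩ := seg1 3 (Or.inr rfl)
    obtain ⟨d1, c1, m1⟩ := seg2 1 (Or.inl rfl)
    obtain ⟨d2, c2, m2⟩ := seg2 2 (Or.inr rfl)
    set K : ℂ := (2 * (Real.pi : ℂ) * Complex.I)⁻¹ with hK
    set C : ℂ := K * (c0 + c3 + (c1 + c2)) with hC
    set H : ℂ → ℂ := fun z => h z + C / (z - p) with hHdef
    have hH : DifferentiableOn ℂ H SquareD := hh.add (hpd C _ (hsub1.trans subset_union_left))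
    have hbd : ∀ z ∈ SquareD, ‖C / (z - p)‖ ≤ ‖C‖ / (Real.pi / 4) := by
      intro z hz
      rw [norm_div]
      gcongr
      exact hp z (Or.inl (hsub1 hz))
    have hL : MemLp H 2 (volume.restrict SquareD) := by
      apply (D_weight h hh hw).add
      haveI : IsFiniteMeasure (volume.restrict SquareD) := ⟨by
        rw [Measure.restrict_apply_univ]; exact volume_D_lt⟩
      refine MemLp.of_bound ((hpd C _ (hsub1.trans subset_union_left)).continuousOn.aestronglyMeasurable
        isOpen_D.measurableSet) (‖C‖ / (Real.pi / 4)) ?_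
      exact (ae_restrict_iff' isOpen_D.measurableSet).2 (Filter.Eventually.of_forall hbd)
    obtain ⟨B, hB⟩ := gam_bdd h hh hw
    have hB' : ∀ t ∈ Ioo (0:ℝ) 1, ‖H (gam t)‖ ≤ B + ‖C‖ / (Real.pi / 4) := fun t ht =>
      (norm_add_le _ _).trans (add_le_add (hB t ht) (hbd _ (gam_mem ht)))
    obtain ⟨i1, i2⟩ := gam_int hH hB'
    obtain ⟨b₁, b₂, c, e1, e2, l1, l2, hs⟩ := split_B p _ hε hp H hH hL i1 i2
    refine ⟨fun z => K * ((F 0 z - c0 / (z - p)) + (F 3 z - c3 / (z - p))) + (b₁ z + c / (z - p)),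
      fun z => K * ((F 1 z - c1 / (z - p)) + (F 2 z - c2 / (z - p))) + (b₂ z - c / (z - p)),
      memA2_of ?_ ?_, memA2_of ?_ ?_, ?_⟩
    · have q := fun c => hpd c SectorDelta subset_union_left
      exact (((d0.sub (q c0)).add (d3.sub (q c3))).const_mul K).add (e1.add (q c))
    · exact ((m0.add m3).const_mul K).add l1
    · have q := fun c => hpd c SectorPiDelta subset_union_right
      exact (((d1.sub (q c1)).add (d2.sub (q c2))).const_mul K).add (e2.sub (q c))
    · exact ((m1.add m2).const_mul K).add l2
    · intro z hz
      have h1 : cauchyD g z = K * (F 0 z + F 1 z + F 2 z + F 3 z) := by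
        rw [cauchyD, Fin.sum_univ_four]
      have h2 : b₁ z + b₂ z = h z + C / (z - p) := hs z hz
      rw [hf z hz, h1, eq_sub_of_add_eq h2.symm, hC]
      ring
  · intro f₁ f₂ h1 h2
    refine memA2_of ((h1.1.mono hsub1).add (h2.1.mono hsub2)) ?_
    exact ((memLp_of_memA2 isOpen_Delta h1).mono_measure (Measure.restrict_mono hsub1 le_rfl)).add
      ((memLp_of_memA2 isOpen_PiDelta h2).mono_measure (Measure.restrict_mono hsub2 le_rfl))

end
end

section
/- The normalized Laplace transform (ℒf)(s) = (1/√π) ∫₀^∞ e^{−st} f(t) dt is a unitary operator from L²(ℝ₊, dt/t) onto the Bergman space A²(ℂ₊) of the right half-plane ℂ₊ = {z ∈ ℂ : Re z > 0}: for every f with ∫₀^∞ |f(t)|² dt/t < ∞, the function ℒf is holomorphic on ℂ₊ and ∫_{ℂ₊} |(ℒf)(z)|² dA(z) = ∫₀^∞ |f(t)|² dt/t; moreover every element of A²(ℂ₊) equals ℒf for such an f. -/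
open MeasureTheory Set

noncomputable section

/-- The right half-plane `ℂ₊`. -/
def RightHalfPlane : Set ℂ := {z : ℂ | 0 < z.re}

/-- The normalized Laplace transform `(ℒf)(s) = (1/√π) ∫₀^∞ e^{−st} f(t) dt`. -/
def normLaplace (f : ℝ → ℂ) (s : ℂ) : ℂ :=
  ((Real.sqrt Real.pi : ℝ) : ℂ)⁻¹ * ∫ t in Ioi (0:ℝ), Complex.exp (-s * (t : ℂ)) * f t

open FourierTransform SchwartzMap in
theorem nl_plancherel (f : ℝ → ℂ) (h1 : Integrable f) (h2 : MemLp f 2) :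
    eLpNorm (𝓕 f) 2 volume = eLpNorm f 2 volume := by
  have key : 𝓕 f =ᵐ[volume] (𝓕 (h2.toLp f) : Lp ℂ 2 (volume : Measure ℝ)) := by
    apply ae_eq_of_integral_contDiff_smul_eq
    · exact (VectorFourier.fourierIntegral_continuous Real.continuous_fourierChar (by exact continuous_inner) h1).locallyIntegrable
    · exact (Lp.memLp _).locallyIntegrable (by norm_num)
    · intro g hg hgs
      have hgs' : HasCompactSupport (fun x => (g x : ℂ)) := hgs.comp_left (g := fun r : ℝ => (r : ℂ)) (by simp)
      have hg' : ContDiff ℝ (⊤ : ℕ∞) (fun x => (g x : ℂ)) := Complex.ofRealCLM.contDiff.comp hg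
      let G : 𝓢(ℝ, ℂ) := hgs'.toSchwartzMap hg'
      have hG : ∀ x, G x = (g x : ℂ) := fun x => rfl
      have e := congrArg (fun T => T G) (Lp.fourier_toTemperedDistribution_eq (h2.toLp f))
      simp only [TemperedDistribution.fourier_apply, Lp.toTemperedDistribution_apply] at e
      have e2 : ∫ x, g x • (𝓕 (h2.toLp f) : Lp ℂ 2 (volume : Measure ℝ)) x = ∫ x, G x • (𝓕 (h2.toLp f) : Lp ℂ 2 (volume : Measure ℝ)) x := by
        simp [hG]
      rw [e2, ← e]
      have e3 : ∫ x, (𝓕 G) x • (h2.toLp f) x = ∫ x, (𝓕 G) x • f x := by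
        apply integral_congr_ae
        filter_upwards [h2.coeFn_toLp] with x hx
        rw [hx]
      rw [e3]
      have e4 := VectorFourier.integral_fourierIntegral_smul_eq_flip (L := innerₗ ℝ) (μ := volume) (ν := volume) (f := G) (g := f)
        Real.continuous_fourierChar (by exact continuous_inner) G.integrable h1
      rw [SchwartzMap.fourier_coe]
      have e5 : (innerₗ ℝ).flip = innerₗ ℝ := flip_innerₗ ℝ
      rw [e5] at e4
      calc ∫ x, g x • 𝓕 f x = ∫ x, G x • 𝓕 f x := by simp [hG]
        _ = _ := e4.symm
  rw [eLpNorm_congr_ae key, ← eLpNorm_congr_ae h2.coeFn_toLp]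
  have := Lp.norm_fourier_eq (h2.toLp f)
  rw [Lp.norm_def, Lp.norm_def, ENNReal.toReal_eq_toReal_iff' (Lp.eLpNorm_ne_top _) (Lp.eLpNorm_ne_top _)] at this
  exact this

theorem nl_meanvalue (G : ℂ → ℂ) (hG : DifferentiableOn ℂ G (Metric.ball 0 1))
    (hi : IntegrableOn G (Metric.ball 0 1)) :
    ∫ z in Metric.ball (0:ℂ) 1, G z = Real.pi * G 0 := by
  have hm : Measurable ((Metric.ball (0:ℂ) 1).indicator G) := by
    classical
    rw [← Set.piecewise_eq_indicator]
    exact hG.continuousOn.measurable_piecewise continuousOn_const Metric.isOpen_ball.measurableSet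
  have hi' : Integrable ((Metric.ball (0:ℂ) 1).indicator G) :=
    (integrable_indicator_iff Metric.isOpen_ball.measurableSet).2 hi
  set g := (Metric.ball (0:ℂ) 1).indicator G with hgdef
  rw [← integral_indicator Metric.isOpen_ball.measurableSet, ← Complex.integral_comp_polarCoord_symm]
  have hmp : Measurable (fun p : ℝ × ℝ => p.1 • g (Complex.polarCoord.symm p)) := by
    have : Measurable (fun p : ℝ × ℝ => Complex.polarCoord.symm p) := by
      simp only [Complex.polarCoord_symm_apply]
      fun_prop
    exact measurable_fst.smul (hm.comp this)
  have hintg : IntegrableOn (fun p : ℝ × ℝ => p.1 • g (Complex.polarCoord.symm p)) polarCoord.target := by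
    refine ⟨hmp.aestronglyMeasurable, ?_⟩
    have h2 := hi'.2
    rw [HasFiniteIntegral] at h2 ⊢
    rw [← Complex.lintegral_comp_polarCoord_symm] at h2
    convert h2 using 1
    apply setLIntegral_congr_fun polarCoord.open_target.measurableSet
    intro p hp
    have : 0 < p.1 := by simpa using hp.1
    simp only [enorm_smul, smul_eq_mul, Real.enorm_eq_ofReal this.le]
  rw [polarCoord_target] at hintg ⊢
  rw [Measure.volume_eq_prod, setIntegral_prod _ hintg]
  have hin : ∀ r ∈ Ioi (0:ℝ), ∫ θ in Ioo (-Real.pi) Real.pi, r • g (Complex.polarCoord.symm (r, θ))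
      = (Ioo (0:ℝ) 1).indicator (fun r => (2 * Real.pi * r) • G 0) r := by
    intro r hr
    have hr0 : 0 < r := hr
    rw [integral_smul]
    by_cases h1 : r < 1
    · have hav : Real.circleAverage G 0 r = G 0 := by
        apply DiffContOnCl.circleAverage
        rw [abs_of_pos hr0]
        exact (hG.mono (Metric.closedBall_subset_ball h1)).diffContOnCl_ball (le_refl _) 
      rw [indicator_of_mem (by exact ⟨hr0, h1⟩), ← hav, Real.circleAverage_def]
      have : ∫ θ in Ioo (-Real.pi) Real.pi, g (Complex.polarCoord.symm (r, θ)) = ∫ θ in (0:ℝ)..2 * Real.pi, G (circleMap 0 r θ) := by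
        have hper : Function.Periodic (fun θ => G (circleMap 0 r θ)) (2 * Real.pi) := fun θ => by
          simp only [periodic_circleMap 0 r θ]
        have := hper.intervalIntegral_add_eq 0 (-Real.pi)
        rw [zero_add] at this
        rw [this, show -Real.pi + 2 * Real.pi = Real.pi by ring,
          intervalIntegral.integral_of_le (by linarith [Real.pi_pos]), integral_Ioc_eq_integral_Ioo]
        apply setIntegral_congr_fun measurableSet_Ioo
        intro θ _
        have : Complex.polarCoord.symm (r, θ) = circleMap 0 r θ := by
          simp [Complex.polarCoord_symm_apply, circleMap, Complex.exp_mul_I]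
        simp only [this]
        rw [hgdef, indicator_of_mem]
        simp [abs_of_pos hr0, h1]
      rw [this, smul_smul]
      congr 1
      field_simp
    · rw [indicator_of_notMem (by intro h; exact h1 h.2)]
      have : ∀ θ, g (Complex.polarCoord.symm (r, θ)) = 0 := by
        intro θ
        rw [hgdef, indicator_of_notMem]
        rw [mem_ball_zero_iff, Complex.norm_polarCoord_symm, abs_of_pos hr0]
        exact h1
      simp only [this]
      simp
  rw [setIntegral_congr_fun measurableSet_Ioi hin, setIntegral_indicator measurableSet_Ioo]
  have : Ioi (0:ℝ) ∩ Ioo 0 1 = Ioo 0 1 := by ext x; simp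
  rw [this, integral_smul_const, ← integral_Ioc_eq_integral_Ioo, ← intervalIntegral.integral_of_le zero_le_one,
    intervalIntegral.integral_const_mul, integral_id]
  rw [Complex.real_smul]
  congr 1
  push_cast
  ring

theorem nl_memLp_weight (n : ℕ) {a : ℝ} (ha : 0 < a) :
    MemLp (fun t : ℝ => t ^ n * Real.sqrt t * Real.exp (-a * t)) 2 (volume.restrict (Ioi 0)) := by
  rw [memLp_two_iff_integrable_sq (by fun_prop)]
  have := integrableOn_rpow_mul_exp_neg_mul_rpow (p := 1) (s := 2 * n + 1) (b := 2 * a)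
    (by have : (0:ℝ) ≤ n := n.cast_nonneg; linarith) one_pos (by positivity)
  refine (integrableOn_congr_fun ?_ measurableSet_Ioi).1 this
  intro t ht
  have ht0 : 0 < t := ht
  have h1 : (t : ℝ) ^ (2 * (n:ℝ) + 1) = t ^ (2 * n + 1) := by
    rw [← Real.rpow_natCast]; push_cast; rfl
  have h2 : Real.exp (-(2 * a) * t) = Real.exp (-a * t) ^ 2 := by
    rw [← Real.exp_nat_mul]; congr 1; push_cast; ring
  simp only [h1, Real.rpow_one, h2, mul_pow, Real.sq_sqrt ht0.le]
  ring

theorem nl_memLp_div {f : ℝ → ℂ} (hf : Measurable f)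
    (hi : ∫⁻ t in Ioi (0:ℝ), ENNReal.ofReal (‖f t‖ ^ 2 / t) < ⊤) :
    MemLp (fun t : ℝ => ‖f t‖ / Real.sqrt t) 2 (volume.restrict (Ioi 0)) := by
  have hm : Measurable (fun t : ℝ => ‖f t‖ / Real.sqrt t) := by fun_prop
  rw [memLp_two_iff_integrable_sq hm.aestronglyMeasurable]
  refine ⟨(hm.pow_const 2).aestronglyMeasurable, ?_⟩
  rw [hasFiniteIntegral_iff_ofReal (Filter.Eventually.of_forall fun t => by positivity)]
  convert hi using 1
  apply setLIntegral_congr_fun measurableSet_Ioi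
  intro t ht
  have ht0 : 0 < t := ht
  simp only [div_pow, Real.sq_sqrt ht0.le]

theorem nl_integrable {f : ℝ → ℂ} (hf : Measurable f)
    (hi : ∫⁻ t in Ioi (0:ℝ), ENNReal.ofReal (‖f t‖ ^ 2 / t) < ⊤) (n : ℕ) {a : ℝ} (ha : 0 < a) :
    IntegrableOn (fun t : ℝ => t ^ n * Real.exp (-a * t) * ‖f t‖) (Ioi 0) := by
  have := (nl_memLp_weight n ha).integrable_mul (nl_memLp_div hf hi)
  refine (integrableOn_congr_fun ?_ measurableSet_Ioi).1 this
  intro t ht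
  have ht0 : 0 < Real.sqrt t := Real.sqrt_pos.2 ht
  simp only [Pi.mul_apply]
  field_simp

theorem nl_norm_cexp (s : ℂ) (t : ℝ) : ‖Complex.exp (-s * (t : ℂ))‖ = Real.exp (-s.re * t) := by
  rw [Complex.norm_exp]; simp

theorem nl_integrable' {f : ℝ → ℂ} (hf : Measurable f)
    (hi : ∫⁻ t in Ioi (0:ℝ), ENNReal.ofReal (‖f t‖ ^ 2 / t) < ⊤) {s : ℂ} (hs : 0 < s.re) :
    IntegrableOn (fun t : ℝ => Complex.exp (-s * (t : ℂ)) * f t) (Ioi 0) := by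
  refine Integrable.mono (nl_integrable hf hi 0 hs) (by fun_prop) (Filter.Eventually.of_forall fun t => ?_)
  rw [norm_mul, nl_norm_cexp]
  simp [abs_of_pos (Real.exp_pos _)]

theorem nl_differentiableOn {f : ℝ → ℂ} (hf : Measurable f)
    (hi : ∫⁻ t in Ioi (0:ℝ), ENNReal.ofReal (‖f t‖ ^ 2 / t) < ⊤) :
    DifferentiableOn ℂ (normLaplace f) RightHalfPlane := by
  intro s hs
  have hs0 : 0 < s.re := hs
  apply DifferentiableAt.differentiableWithinAt
  unfold normLaplace
  apply DifferentiableAt.const_mul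
  have hnhds : {z : ℂ | s.re / 2 < z.re} ∈ nhds s :=
    (isOpen_lt continuous_const Complex.continuous_re).mem_nhds (by simpa using by linarith)
  refine (hasDerivAt_integral_of_dominated_loc_of_deriv_le (μ := volume.restrict (Ioi (0:ℝ)))
    (F := fun (z : ℂ) (t : ℝ) => Complex.exp (-z * (t : ℂ)) * f t)
    (F' := fun (z : ℂ) (t : ℝ) => Complex.exp (-z * (t : ℂ)) * (-(t:ℂ)) * f t)
    (bound := fun t : ℝ => t ^ 1 * Real.exp (-(s.re / 2) * t) * ‖f t‖)
    hnhds ?_ ?_ ?_ ?_ ?_ ?_).2.differentiableAt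
  · exact Filter.Eventually.of_forall fun z => by fun_prop
  · exact nl_integrable' hf hi hs0
  · fun_prop
  · filter_upwards [ae_restrict_mem measurableSet_Ioi] with t ht z hz
    have ht0 : 0 < t := ht
    have hz' : s.re / 2 < z.re := hz
    rw [norm_mul, norm_mul, nl_norm_cexp, norm_neg, Complex.norm_real, Real.norm_of_nonneg ht0.le, pow_one,
      mul_comm (Real.exp _)]
    gcongr
  · exact nl_integrable hf hi 1 (half_pos hs0)
  · refine Filter.Eventually.of_forall fun t z _ => ?_
    have : HasDerivAt (fun z : ℂ => -z * (t:ℂ)) (-(t:ℂ)) z := by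
      simpa using (hasDerivAt_id z).neg.mul_const (t:ℂ)
    exact this.cexp.mul_const (f t)

theorem nl_kernel {s : ℂ} (hs : 0 < s.re) :
    ∫ t in Ioi (0:ℝ), Complex.exp (-s * (t:ℂ)) * (t:ℂ) = 1 / s ^ 2 := by
  have hs0 : s ≠ 0 := by rintro rfl; simp at hs
  have hd : ∀ t ∈ Ici (0:ℝ), HasDerivAt (fun t : ℝ => -(((t:ℂ) / s + 1 / s ^ 2) * Complex.exp (-s * (t:ℂ))))
      (Complex.exp (-s * (t:ℂ)) * (t:ℂ)) t := by
    intro t _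
    have h1 : HasDerivAt (fun z : ℂ => -((z / s + 1 / s ^ 2) * Complex.exp (-s * z)))
      (Complex.exp (-s * (t:ℂ)) * (t:ℂ)) (t:ℂ) := by
      have a1 : HasDerivAt (fun z : ℂ => z / s + 1 / s ^ 2) (1 / s) (t:ℂ) :=
        ((hasDerivAt_id (t:ℂ)).div_const s).add_const _
      have a2 : HasDerivAt (fun z : ℂ => Complex.exp (-s * z)) (Complex.exp (-s * (t:ℂ)) * (-s)) (t:ℂ) := by
        have : HasDerivAt (fun z : ℂ => -s * z) (-s) (t:ℂ) := by
          simpa using (hasDerivAt_id (t:ℂ)).const_mul (-s)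
        exact this.cexp
      refine (a1.mul a2).neg.congr_deriv ?_
      field_simp
      ring
    exact h1.comp_ofReal
  have hintg : IntegrableOn (fun t : ℝ => Complex.exp (-s * (t:ℂ)) * (t:ℂ)) (Ioi 0) := by
    have := integrableOn_rpow_mul_exp_neg_mul_rpow (p := 1) (s := 1) (b := s.re) (by norm_num) one_pos hs
    refine Integrable.mono this (by fun_prop) (Filter.Eventually.of_forall fun t => ?_)
    rw [norm_mul, nl_norm_cexp]
    simp [mul_comm]
  have hlim : Filter.Tendsto (fun t : ℝ => -(((t:ℂ) / s + 1 / s ^ 2) * Complex.exp (-s * (t:ℂ)))) Filter.atTop (nhds 0) := by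
    have h1 : Filter.Tendsto (fun t : ℝ => (t:ℂ) * Complex.exp (-s * (t:ℂ))) Filter.atTop (nhds 0) := by
      rw [tendsto_zero_iff_norm_tendsto_zero]
      have := tendsto_rpow_mul_exp_neg_mul_atTop_nhds_zero 1 s.re hs
      refine this.congr' ?_
      filter_upwards [Filter.eventually_gt_atTop 0] with t ht
      rw [norm_mul, nl_norm_cexp, Complex.norm_real, Real.norm_of_nonneg ht.le, Real.rpow_one]
    have h2 : Filter.Tendsto (fun t : ℝ => Complex.exp (-s * (t:ℂ))) Filter.atTop (nhds 0) := by
      rw [tendsto_zero_iff_norm_tendsto_zero]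
      have := tendsto_rpow_mul_exp_neg_mul_atTop_nhds_zero 0 s.re hs
      refine this.congr' ?_
      filter_upwards [Filter.eventually_gt_atTop 0] with t ht
      rw [nl_norm_cexp, Real.rpow_zero, one_mul]
    have := ((h1.const_mul (1 / s)).add (h2.const_mul (1 / s ^ 2))).neg
    simp only [mul_zero, add_zero, neg_zero] at this
    refine this.congr fun t => ?_
    ring
  rw [integral_Ioi_of_hasDerivAt_of_tendsto' hd hintg hlim]
  simp

theorem nl_measurable_indicator {F : ℂ → ℂ} (hF : DifferentiableOn ℂ F RightHalfPlane) :
    Measurable (RightHalfPlane.indicator F) := by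
  classical
  rw [← Set.piecewise_eq_indicator]
  exact hF.continuousOn.measurable_piecewise continuousOn_const
    (isOpen_lt continuous_const Complex.continuous_re).measurableSet

theorem nl_rhp_meas : MeasurableSet RightHalfPlane :=
  (isOpen_lt continuous_const Complex.continuous_re).measurableSet

theorem nl_memLp_two {f : ℝ → ℂ} (hf : Measurable f)
    (hi : ∫⁻ t in Ioi (0:ℝ), ENNReal.ofReal (‖f t‖ ^ 2 / t) < ⊤) {x : ℝ} (hx : 0 < x) :
    MemLp ((Ioi (0:ℝ)).indicator fun t : ℝ => Complex.exp (-(x:ℂ) * (t : ℂ)) * f t) 2 volume := by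
  rw [memLp_indicator_iff_restrict measurableSet_Ioi, memLp_two_iff_integrable_sq_norm (by fun_prop)]
  have h0 := (memLp_two_iff_integrable_sq (nl_memLp_div hf hi).1).1 (nl_memLp_div hf hi)
  refine Integrable.mono' (h0.const_mul (1 / (2 * x))) (by fun_prop) ?_
  filter_upwards [ae_restrict_mem measurableSet_Ioi] with t ht
  have ht0 : 0 < t := ht
  rw [norm_mul, nl_norm_cexp, Complex.ofReal_re, mul_pow, div_pow, Real.sq_sqrt ht0.le, norm_mul,
    Real.norm_of_nonneg (by positivity), Real.norm_of_nonneg (by positivity)]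
  have h1 : Real.exp (-x * t) ^ 2 = (Real.exp (2 * x * t))⁻¹ := by
    rw [← Real.exp_nat_mul, ← Real.exp_neg]; congr 1; push_cast; ring
  have h2 : 2 * x * t ≤ Real.exp (2 * x * t) := by linarith [Real.add_one_le_exp (2 * x * t)]
  rw [h1]
  have h3 : (Real.exp (2 * x * t))⁻¹ ≤ (2 * x * t)⁻¹ := inv_anti₀ (by positivity) h2
  calc _ ≤ (2 * x * t)⁻¹ * ‖f t‖ ^ 2 := by gcongr
    _ = _ := by field_simp

theorem nl_enorm_sq (z : ℂ) : ENNReal.ofReal (‖z‖ ^ 2) = ‖z‖ₑ ^ 2 := by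
  rw [ENNReal.ofReal_pow (norm_nonneg _), ofReal_norm]

theorem nl_eLpNorm_two {α : Type*} [MeasurableSpace α] (μ : Measure α) (g : α → ℂ) :
    eLpNorm g 2 μ ^ 2 = ∫⁻ x, ‖g x‖ₑ ^ 2 ∂μ := by
  have := eLpNorm_nnreal_pow_eq_lintegral (μ := μ) (f := g) (p := 2) (by norm_num)
  simpa using this

open FourierTransform in
theorem nl_slice {f : ℝ → ℂ} (hf : Measurable f)
    (hi : ∫⁻ t in Ioi (0:ℝ), ENNReal.ofReal (‖f t‖ ^ 2 / t) < ⊤) {x : ℝ} (hx : 0 < x) :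
    ∫⁻ y : ℝ, ENNReal.ofReal (‖normLaplace f (⟨x, y⟩ : ℂ)‖ ^ 2)
      = ∫⁻ t in Ioi (0:ℝ), ENNReal.ofReal (2 * Real.exp (-(2 * t) * x)) * ENNReal.ofReal (‖f t‖ ^ 2) := by
  set g := (Ioi (0:ℝ)).indicator fun t : ℝ => Complex.exp (-(x:ℂ) * (t : ℂ)) * f t with hg
  have hg1 : Integrable g := (integrable_indicator_iff measurableSet_Ioi).2
    (nl_integrable' hf hi (s := (x:ℂ)) (by simpa using hx))
  have hg2 : MemLp g 2 := nl_memLp_two hf hi hx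
  have hP := nl_plancherel g hg1 hg2
  have hP2 : ∫⁻ y, ‖𝓕 g y‖ₑ ^ 2 = ∫⁻ t, ‖g t‖ₑ ^ 2 := by
    rw [← nl_eLpNorm_two, ← nl_eLpNorm_two, hP]
  have hN : ∀ y : ℝ, normLaplace f (⟨x, y⟩ : ℂ)
      = ((Real.sqrt Real.pi : ℝ) : ℂ)⁻¹ * 𝓕 g ((2 * Real.pi)⁻¹ * y) := by
    intro y
    unfold normLaplace
    congr 1
    rw [Real.fourier_real_eq_integral_exp_smul, ← integral_indicator measurableSet_Ioi]
    congr 1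
    ext t
    by_cases ht : t ∈ Ioi (0:ℝ)
    · rw [hg, indicator_of_mem ht, indicator_of_mem ht, smul_eq_mul, ← mul_assoc, ← Complex.exp_add]
      congr 2
      have : (Real.pi : ℂ) ≠ 0 := by exact_mod_cast Real.pi_ne_zero
      have h2 : (⟨x, y⟩ : ℂ) = x + y * Complex.I := Complex.mk_eq_add_mul_I x y
      rw [h2]
      push_cast
      field_simp
      ring
    · rw [hg, indicator_of_notMem ht, indicator_of_notMem ht, smul_zero]
  have hc : Continuous (𝓕 g) := VectorFourier.fourierIntegral_continuous Real.continuous_fourierChar (by exact continuous_inner) hg1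
  have hsc : ∫⁻ y : ℝ, ‖𝓕 g ((2 * Real.pi)⁻¹ * y)‖ₑ ^ 2 = ENNReal.ofReal (2 * Real.pi) * ∫⁻ y, ‖𝓕 g y‖ₑ ^ 2 := by
    have h1 := Real.map_volume_mul_left (a := (2 * Real.pi)⁻¹) (by positivity)
    have h2 : ∫⁻ y, ‖𝓕 g y‖ₑ ^ 2 ∂(Measure.map ((2 * Real.pi)⁻¹ * ·) volume) = ∫⁻ y : ℝ, ‖𝓕 g ((2 * Real.pi)⁻¹ * y)‖ₑ ^ 2 :=
      lintegral_map (by fun_prop) (by fun_prop)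
    rw [← h2, h1, lintegral_smul_measure, inv_inv, abs_of_pos (by positivity), smul_eq_mul]
  have hpi : ‖((Real.sqrt Real.pi : ℝ) : ℂ)⁻¹‖ₑ ^ 2 = ENNReal.ofReal (Real.pi⁻¹) := by
    rw [← nl_enorm_sq, norm_inv, Complex.norm_real, Real.norm_of_nonneg (Real.sqrt_nonneg _), inv_pow,
      Real.sq_sqrt Real.pi_pos.le]
  calc ∫⁻ y : ℝ, ENNReal.ofReal (‖normLaplace f (⟨x, y⟩ : ℂ)‖ ^ 2)
      = ∫⁻ y : ℝ, ENNReal.ofReal (Real.pi⁻¹) * ‖𝓕 g ((2 * Real.pi)⁻¹ * y)‖ₑ ^ 2 := by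
        congr 1; ext y
        rw [nl_enorm_sq, hN, enorm_mul, mul_pow, hpi]
    _ = ENNReal.ofReal 2 * ∫⁻ t, ‖g t‖ₑ ^ 2 := by
        have hme : Measurable (fun y : ℝ => ‖𝓕 g ((2 * Real.pi)⁻¹ * y)‖ₑ ^ 2) :=
          (hc.measurable.comp (measurable_const_mul _)).enorm.pow_const 2
        rw [lintegral_const_mul _ hme, hsc, hP2, ← mul_assoc, ← ENNReal.ofReal_mul (by positivity)]
        congr 2
        field_simp
    _ = ∫⁻ t in Ioi (0:ℝ), ENNReal.ofReal 2 * ‖Complex.exp (-(x:ℂ) * (t : ℂ)) * f t‖ₑ ^ 2 := by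
        rw [lintegral_const_mul _ (by fun_prop), ← lintegral_indicator measurableSet_Ioi]
        congr 2; ext t
        by_cases ht : t ∈ Ioi (0:ℝ)
        · rw [hg, indicator_of_mem ht, indicator_of_mem ht]
        · rw [hg, indicator_of_notMem ht, indicator_of_notMem ht]; simp
    _ = _ := by
        congr 1; ext t
        rw [← nl_enorm_sq, norm_mul, nl_norm_cexp, ← ENNReal.ofReal_mul (by positivity),
          ← ENNReal.ofReal_mul (by positivity), mul_pow, ← Real.exp_nat_mul, ← mul_assoc]
        congr 4
        simp; ring

theorem nl_isometry {f : ℝ → ℂ} (hf : Measurable f)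
    (hi : ∫⁻ t in Ioi (0:ℝ), ENNReal.ofReal (‖f t‖ ^ 2 / t) < ⊤) :
    ∫⁻ z in RightHalfPlane, ENNReal.ofReal (‖normLaplace f z‖ ^ 2)
          = ∫⁻ t in Ioi (0:ℝ), ENNReal.ofReal (‖f t‖ ^ 2 / t) := by
  have hm := nl_measurable_indicator (nl_differentiableOn hf hi)
  have e1 : ∫⁻ z in RightHalfPlane, ENNReal.ofReal (‖normLaplace f z‖ ^ 2)
      = ∫⁻ z, ENNReal.ofReal (‖RightHalfPlane.indicator (normLaplace f) z‖ ^ 2) := by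
    rw [← lintegral_indicator nl_rhp_meas]
    congr 1; ext z
    by_cases hz : z ∈ RightHalfPlane
    · rw [indicator_of_mem hz, indicator_of_mem hz]
    · rw [indicator_of_notMem hz, indicator_of_notMem hz]; simp
  rw [e1, ← (Complex.volume_preserving_equiv_real_prod.symm).lintegral_comp_emb
    Complex.measurableEquivRealProd.symm.measurableEmbedding, Measure.volume_eq_prod, lintegral_prod]
  swap
  · have : Measurable (fun z => ENNReal.ofReal (‖RightHalfPlane.indicator (normLaplace f) z‖ ^ 2)) := by fun_prop
    exact (this.comp Complex.measurableEquivRealProd.symm.measurable).aemeasurable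
  have e2 : ∀ x : ℝ, ∫⁻ y : ℝ, ENNReal.ofReal (‖RightHalfPlane.indicator (normLaplace f) (Complex.measurableEquivRealProd.symm (x, y))‖ ^ 2)
      = (Ioi (0:ℝ)).indicator (fun x => ∫⁻ t in Ioi (0:ℝ), ENNReal.ofReal (2 * Real.exp (-(2 * t) * x)) * ENNReal.ofReal (‖f t‖ ^ 2)) x := by
    intro x
    have e3 : ∀ y, Complex.measurableEquivRealProd.symm (x, y) = (⟨x, y⟩ : ℂ) := fun y => rfl
    simp only [e3]
    by_cases hx : x ∈ Ioi (0:ℝ)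
    · rw [indicator_of_mem hx, ← nl_slice hf hi hx]
      congr 1; ext y
      rw [indicator_of_mem (show (⟨x, y⟩ : ℂ) ∈ RightHalfPlane from hx)]
    · rw [indicator_of_notMem hx]
      have : ∀ y, RightHalfPlane.indicator (normLaplace f) (⟨x, y⟩ : ℂ) = 0 := fun y =>
        indicator_of_notMem (show (⟨x, y⟩ : ℂ) ∉ RightHalfPlane from hx) _
      simp [this]
  simp only [e2]
  rw [lintegral_indicator measurableSet_Ioi, lintegral_lintegral_swap (by fun_prop)]
  apply setLIntegral_congr_fun measurableSet_Ioi
  intro t ht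
  have ht0 : 0 < t := ht
  simp only
  rw [lintegral_mul_const _ (by fun_prop)]
  have h1 : IntegrableOn (fun x => 2 * Real.exp (-(2 * t) * x)) (Ioi 0) :=
    (integrableOn_exp_mul_Ioi (by linarith) 0).const_mul 2
  rw [← ofReal_integral_eq_lintegral_ofReal h1 (Filter.Eventually.of_forall fun x => by positivity),
    integral_const_mul, integral_exp_mul_Ioi (by linarith) 0, ← ENNReal.ofReal_mul']
  · congr 1
    simp
    field_simp
  · positivity

open ComplexConjugate in
theorem nl_vanish {H : ℂ → ℂ} (hH : DifferentiableOn ℂ H RightHalfPlane) {w : ℂ} (hw : 0 < w.re)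
    (hintg : IntegrableOn (fun z => H z * conj (1 / (z + conj w) ^ 2)) RightHalfPlane)
    (h0 : ∫ z in RightHalfPlane, H z * conj (1 / (z + conj w) ^ 2) = 0) : H w = 0 := by
  have hsum : w + conj w = ((2 * w.re : ℝ) : ℂ) := by rw [Complex.add_conj]
  have hsum0 : w + conj w ≠ 0 := by rw [hsum]; exact_mod_cast (by positivity)
  have hne : ∀ z ∈ RightHalfPlane, z + conj w ≠ 0 := by
    intro z hz h
    have hz' : 0 < z.re := hz
    have := congrArg Complex.re h
    simp at this
    linarith
  have hball : ∀ ζ ∈ Metric.ball (0:ℂ) 1, 1 - ζ ≠ 0 := by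
    intro ζ hζ h
    have : ζ = 1 := (sub_eq_zero.1 h).symm
    simp [this] at hζ
  have hφ : ∀ ζ ∈ Metric.ball (0:ℂ) 1, (w + conj w * ζ) / (1 - ζ) ∈ RightHalfPlane := by
    intro ζ hζ
    have h1 : 0 < Complex.normSq (1 - ζ) := Complex.normSq_pos.2 (hball ζ hζ)
    have h2 : Complex.normSq ζ < 1 := by
      rw [Complex.normSq_eq_norm_sq]
      have := mem_ball_zero_iff.1 hζ
      nlinarith [norm_nonneg ζ]
    show 0 < ((w + conj w * ζ) / (1 - ζ)).re
    have h3 : ((w + conj w * ζ) / (1 - ζ)).re = w.re * (1 - Complex.normSq ζ) / Complex.normSq (1 - ζ) := by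
      rw [Complex.div_re, ← add_div]
      congr 1
      simp [Complex.normSq_apply]
      ring
    rw [h3]
    have : 0 < 1 - Complex.normSq ζ := by linarith
    positivity
  have hdψ : ∀ z ∈ RightHalfPlane, HasDerivAt (fun z => (z - w) / (z + conj w))
      ((w + conj w) / (z + conj w) ^ 2) z := by
    intro z hz
    have := ((hasDerivAt_id z).sub_const w).div ((hasDerivAt_id z).add_const (conj w)) (hne z hz)
    refine this.congr_deriv ?_
    have := hne z hz
    simp only [id]
    field_simp
    ring
  have hinv : ∀ z ∈ RightHalfPlane, (w + conj w * ((z - w) / (z + conj w))) / (1 - (z - w) / (z + conj w)) = z := by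
    intro z hz
    have h1 := hne z hz
    have h2 : 1 - (z - w) / (z + conj w) = (w + conj w) / (z + conj w) := by field_simp; ring
    rw [h2]
    field_simp
    ring
  have hinj : InjOn (fun z => (z - w) / (z + conj w)) RightHalfPlane := by
    intro a ha b hb hab
    have hab' : (a - w) / (a + conj w) = (b - w) / (b + conj w) := hab
    rw [← hinv a ha, ← hinv b hb, hab']
  have himg : (fun z => (z - w) / (z + conj w)) '' RightHalfPlane = Metric.ball 0 1 := by
    ext ζ
    constructor
    · rintro ⟨z, hz, rfl⟩
      have hz' : 0 < z.re := hz
      rw [mem_ball_zero_iff, norm_div, div_lt_one (norm_pos_iff.2 (hne z hz))]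
      apply lt_of_pow_lt_pow_left₀ 2 (norm_nonneg _)
      rw [← Complex.normSq_eq_norm_sq, ← Complex.normSq_eq_norm_sq]
      simp [Complex.normSq_apply]
      nlinarith [mul_pos hz' hw]
    · intro hζ
      refine ⟨_, hφ ζ hζ, ?_⟩
      have h1 := hball ζ hζ
      have h2 : (w + conj w * ζ) / (1 - ζ) + conj w = (w + conj w) / (1 - ζ) := by field_simp; ring
      have h3 : (w + conj w * ζ) / (1 - ζ) - w = ζ * (w + conj w) / (1 - ζ) := by field_simp; ring
      simp only [h2, h3]
      field_simp
  set G : ℂ → ℂ := fun ζ => H ((w + conj w * ζ) / (1 - ζ)) / (1 - ζ) ^ 2 with hGdef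
  have hGd : DifferentiableOn ℂ G (Metric.ball 0 1) := by
    refine DifferentiableOn.div (hH.comp ?_ hφ) (by fun_prop) fun ζ hζ => pow_ne_zero 2 (hball ζ hζ)
    exact DifferentiableOn.div (by fun_prop) (by fun_prop) hball
  have hdet : ∀ c : ℂ, ((ContinuousLinearMap.toSpanSingleton ℂ c).restrictScalars ℝ).det = Complex.normSq c := by
    intro c
    simp [ContinuousLinearMap.det, LinearMap.det_restrictScalars, Algebra.norm_complex_eq]
  have hfd : ∀ z ∈ RightHalfPlane, HasFDerivWithinAt (fun z => (z - w) / (z + conj w))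
      ((ContinuousLinearMap.toSpanSingleton ℂ ((w + conj w) / (z + conj w) ^ 2)).restrictScalars ℝ) RightHalfPlane z :=
    fun z hz => ((hdψ z hz).hasFDerivAt.restrictScalars ℝ).hasFDerivWithinAt
  have hcongr : EqOn (fun z => H z * conj (1 / (z + conj w) ^ 2)) (fun z =>
      |((ContinuousLinearMap.toSpanSingleton ℂ ((w + conj w) / (z + conj w) ^ 2)).restrictScalars ℝ).det| •
        G ((z - w) / (z + conj w))) RightHalfPlane := by
    intro z hz
    have h1 := hne z hz
    have h2 : 1 - (z - w) / (z + conj w) = (w + conj w) / (z + conj w) := by field_simp; ring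
    have h3 : conj (w + conj w) = w + conj w := by rw [hsum, Complex.conj_ofReal]
    have h4 : conj (z + conj w) ≠ 0 := (map_ne_zero _).2 h1
    have h5 := hinv z hz
    simp only [hGdef, h5, hdet, abs_of_nonneg (Complex.normSq_nonneg _)]
    rw [h2, Complex.real_smul, Complex.normSq_eq_conj_mul_self, map_div₀, map_div₀, map_pow, h3, map_one]
    generalize conj (z + conj w) = u at *
    generalize z + conj w = v at *
    generalize w + conj w = q at *
    field_simp
  have hGi : IntegrableOn G (Metric.ball 0 1) := by
    rw [← himg, integrableOn_image_iff_integrableOn_abs_det_fderiv_smul volume nl_rhp_meas hfd hinj]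
    exact (integrableOn_congr_fun hcongr nl_rhp_meas).1 hintg
  have hG0 := nl_meanvalue G hGd hGi
  rw [← himg, integral_image_eq_integral_abs_det_fderiv_smul volume nl_rhp_meas hfd hinj,
    ← setIntegral_congr_fun nl_rhp_meas hcongr, h0] at hG0
  have : (Real.pi : ℂ) ≠ 0 := by exact_mod_cast Real.pi_ne_zero
  simpa [hGdef, this] using hG0.symm

theorem nl_sqrt_lintegral (h : Lp ℂ 2 (volume.restrict (Ioi (0:ℝ)))) :
    ∫⁻ t in Ioi (0:ℝ), ENNReal.ofReal (‖(Real.sqrt t : ℂ) * h t‖ ^ 2 / t)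
      = eLpNorm h 2 (volume.restrict (Ioi (0:ℝ))) ^ 2 := by
  rw [nl_eLpNorm_two]
  apply setLIntegral_congr_fun measurableSet_Ioi
  intro t ht
  have ht0 : 0 < t := ht
  simp only [← nl_enorm_sq]
  rw [norm_mul, Complex.norm_real, Real.norm_of_nonneg (Real.sqrt_nonneg _), mul_pow, Real.sq_sqrt ht0.le]
  congr 1
  field_simp

theorem nl_sqrt_fin (h : Lp ℂ 2 (volume.restrict (Ioi (0:ℝ)))) :
    ∫⁻ t in Ioi (0:ℝ), ENNReal.ofReal (‖(Real.sqrt t : ℂ) * h t‖ ^ 2 / t) < ⊤ := by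
  rw [nl_sqrt_lintegral]
  exact ENNReal.pow_lt_top (Lp.eLpNorm_lt_top h)

theorem nl_sqrt_meas (h : Lp ℂ 2 (volume.restrict (Ioi (0:ℝ)))) :
    Measurable (fun t : ℝ => (Real.sqrt t : ℂ) * h t) := by
  have := (Lp.stronglyMeasurable h).measurable
  fun_prop

theorem nl_memLp_of {F : ℂ → ℂ} (hF : MemA2 RightHalfPlane F) : MemLp F 2 (volume.restrict RightHalfPlane) := by
  refine ⟨hF.1.continuousOn.aestronglyMeasurable nl_rhp_meas, ?_⟩
  have h := hF.2
  simp only [nl_enorm_sq] at h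
  rw [← nl_eLpNorm_two] at h
  by_contra hcon
  rw [not_lt_top_iff] at hcon
  rw [hcon] at h
  simp at h

theorem nl_memA2 (h : Lp ℂ 2 (volume.restrict (Ioi (0:ℝ)))) :
    MemA2 RightHalfPlane (normLaplace fun t : ℝ => (Real.sqrt t : ℂ) * h t) := by
  refine ⟨nl_differentiableOn (nl_sqrt_meas h) (nl_sqrt_fin h), ?_⟩
  rw [nl_isometry (nl_sqrt_meas h) (nl_sqrt_fin h)]
  exact nl_sqrt_fin h

theorem nl_congr {f g : ℝ → ℂ} (h : f =ᵐ[volume.restrict (Ioi (0:ℝ))] g) (z : ℂ) :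
    normLaplace f z = normLaplace g z := by
  unfold normLaplace
  congr 1
  apply integral_congr_ae
  filter_upwards [h] with t ht
  rw [ht]

/-- The Laplace transform as a linear isometry between `L²` spaces. -/
def nlT : Lp ℂ 2 (volume.restrict (Ioi (0:ℝ))) →ₗᵢ[ℂ] Lp ℂ 2 (volume.restrict RightHalfPlane) where
  toFun h := (nl_memLp_of (nl_memA2 h)).toLp _
  map_add' h k := by
    rw [← MemLp.toLp_add]
    apply MemLp.toLp_congr
    filter_upwards [ae_restrict_mem nl_rhp_meas] with z hz
    have hz' : 0 < z.re := hz
    have e : (fun t : ℝ => (Real.sqrt t : ℂ) * (h + k : Lp ℂ 2 (volume.restrict (Ioi (0:ℝ)))) t)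
      =ᵐ[volume.restrict (Ioi (0:ℝ))] fun t : ℝ => (Real.sqrt t : ℂ) * h t + (Real.sqrt t : ℂ) * k t := by
      filter_upwards [Lp.coeFn_add h k] with t ht
      rw [ht, Pi.add_apply, mul_add]
    rw [nl_congr e, Pi.add_apply]
    unfold normLaplace
    rw [← mul_add, ← integral_add (nl_integrable' (nl_sqrt_meas h) (nl_sqrt_fin h) hz')
      (nl_integrable' (nl_sqrt_meas k) (nl_sqrt_fin k) hz')]
    simp only [mul_add]
  map_smul' c h := by
    rw [RingHom.id_apply, ← MemLp.toLp_const_smul]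
    apply MemLp.toLp_congr
    refine Filter.Eventually.of_forall fun z => ?_
    have e : (fun t : ℝ => (Real.sqrt t : ℂ) * (c • h : Lp ℂ 2 (volume.restrict (Ioi (0:ℝ)))) t)
      =ᵐ[volume.restrict (Ioi (0:ℝ))] fun t : ℝ => c * ((Real.sqrt t : ℂ) * h t) := by
      filter_upwards [Lp.coeFn_smul c h] with t ht
      rw [ht, Pi.smul_apply, smul_eq_mul]
      ring
    rw [nl_congr e, Pi.smul_apply, smul_eq_mul]
    unfold normLaplace
    have : ∀ t : ℝ, Complex.exp (-z * (t:ℂ)) * (c * ((Real.sqrt t : ℂ) * h t))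
      = c * (Complex.exp (-z * (t:ℂ)) * ((Real.sqrt t : ℂ) * h t)) := fun t => by ring
    simp only [this]
    rw [integral_const_mul]
    ring
  norm_map' h := by
    show ‖(nl_memLp_of (nl_memA2 h)).toLp _‖ = ‖h‖
    rw [Lp.norm_toLp, Lp.norm_def]
    congr 1
    have e := nl_isometry (nl_sqrt_meas h) (nl_sqrt_fin h)
    rw [nl_sqrt_lintegral] at e
    simp only [nl_enorm_sq] at e
    rw [← nl_eLpNorm_two] at e
    exact (ENNReal.pow_right_strictMono two_ne_zero).injective e

theorem nlT_coe (h : Lp ℂ 2 (volume.restrict (Ioi (0:ℝ)))) :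
    nlT h =ᵐ[volume.restrict RightHalfPlane] normLaplace fun t : ℝ => (Real.sqrt t : ℂ) * h t :=
  MemLp.coeFn_toLp (nl_memLp_of (nl_memA2 h))

open ComplexConjugate in
theorem nlT_kernel {w : ℂ} (hw : 0 < w.re) : ∃ k : Lp ℂ 2 (volume.restrict (Ioi (0:ℝ))),
    nlT k =ᵐ[volume.restrict RightHalfPlane]
      fun z => ((Real.sqrt Real.pi : ℝ) : ℂ)⁻¹ * (1 / (z + conj w) ^ 2) := by
  have hk : MemLp (fun t : ℝ => (Real.sqrt t : ℂ) * Complex.exp (-(conj w) * (t:ℂ))) 2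
      (volume.restrict (Ioi (0:ℝ))) := by
    refine (nl_memLp_weight 0 hw).of_le (by fun_prop) (Filter.Eventually.of_forall fun t => ?_)
    rw [norm_mul, nl_norm_cexp]
    simp
  refine ⟨hk.toLp _, ?_⟩
  filter_upwards [nlT_coe (hk.toLp _), ae_restrict_mem nl_rhp_meas] with z hz hz2
  have hz' : 0 < z.re := hz2
  rw [hz]
  have e : (fun t : ℝ => (Real.sqrt t : ℂ) * (hk.toLp _) t)
      =ᵐ[volume.restrict (Ioi (0:ℝ))] fun t : ℝ => (t : ℂ) * Complex.exp (-(conj w) * (t:ℂ)) := by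
    filter_upwards [hk.coeFn_toLp, ae_restrict_mem measurableSet_Ioi] with t ht ht2
    have ht0 : 0 < t := ht2
    rw [ht, ← mul_assoc, ← Complex.ofReal_mul, Real.mul_self_sqrt ht0.le]
  rw [nl_congr e]
  unfold normLaplace
  rw [← nl_kernel (s := z + conj w) (by simpa using by linarith)]
  congr 2
  ext t
  rw [neg_add, add_mul, Complex.exp_add]
  ring

open ComplexConjugate in
theorem nl_surj {F : ℂ → ℂ} (hF : MemA2 RightHalfPlane F) :
    ∃ f : ℝ → ℂ, Measurable f ∧
          (∫⁻ t in Ioi (0:ℝ), ENNReal.ofReal (‖f t‖ ^ 2 / t) < ⊤) ∧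
          ∀ z ∈ RightHalfPlane, F z = normLaplace f z := by
  have hcomp : IsComplete (LinearMap.range nlT.toLinearMap : Set (Lp ℂ 2 (volume.restrict RightHalfPlane))) := by
    have := nlT.isometry.isUniformInducing.isComplete_range
    exact this
  have : CompleteSpace (LinearMap.range nlT.toLinearMap) := hcomp.completeSpace_coe
  obtain ⟨p, ⟨h, rfl⟩, q, hq, hpq⟩ := (LinearMap.range nlT.toLinearMap).exists_add_mem_mem_orthogonal
    ((nl_memLp_of hF).toLp F)
  refine ⟨fun t => (Real.sqrt t : ℂ) * h t, nl_sqrt_meas h, nl_sqrt_fin h, fun w hw => ?_⟩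
  set N := normLaplace fun t : ℝ => (Real.sqrt t : ℂ) * h t with hN
  have hqe : q =ᵐ[volume.restrict RightHalfPlane] fun z => F z - N z := by
    have hq' : q = (nl_memLp_of hF).toLp F - nlT h := by rw [hpq]; simp
    rw [hq']
    filter_upwards [Lp.coeFn_sub ((nl_memLp_of hF).toLp F) (nlT h), (nl_memLp_of hF).coeFn_toLp, nlT_coe h]
      with z h1 h2 h3
    rw [h1, Pi.sub_apply, h2, h3]
  obtain ⟨k, hk⟩ := nlT_kernel (w := w) hw
  have horth := hq (nlT k) ⟨k, rfl⟩
  have hii := L2.integrable_inner (𝕜 := ℂ) (nlT k) q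
  rw [L2.inner_def] at horth
  have hpi : ((Real.sqrt Real.pi : ℝ) : ℂ) ≠ 0 := by
    exact_mod_cast (Real.sqrt_pos.2 Real.pi_pos).ne'
  have hce : (fun z => ((Real.sqrt Real.pi : ℝ) : ℂ) * inner ℂ (nlT k z) (q z)) =ᵐ[volume.restrict RightHalfPlane]
      fun z => (F z - N z) * conj (1 / (z + conj w) ^ 2) := by
    filter_upwards [hqe, hk] with z h1 h2
    rw [h1, h2, RCLike.inner_apply, map_mul, map_inv₀, Complex.conj_ofReal]
    field_simp
  have := nl_vanish (H := fun z => F z - N z) (hF.1.sub (nl_memA2 h).1) hw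
    ((hii.const_mul _).congr hce) (by rw [← integral_congr_ae hce, integral_const_mul, horth, mul_zero])
  exact sub_eq_zero.1 this

/-- The normalized Laplace transform is unitary from `L²(ℝ₊, dt/t)` onto `A²(ℂ₊)`. -/
theorem normLaplace_unitary_onto_bergman :
    (∀ f : ℝ → ℂ, Measurable f →
        (∫⁻ t in Ioi (0:ℝ), ENNReal.ofReal (‖f t‖ ^ 2 / t) < ⊤) →
        DifferentiableOn ℂ (normLaplace f) RightHalfPlane ∧
        ∫⁻ z in RightHalfPlane, ENNReal.ofReal (‖normLaplace f z‖ ^ 2)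
          = ∫⁻ t in Ioi (0:ℝ), ENNReal.ofReal (‖f t‖ ^ 2 / t)) ∧
    (∀ F : ℂ → ℂ, MemA2 RightHalfPlane F →
        ∃ f : ℝ → ℂ, Measurable f ∧
          (∫⁻ t in Ioi (0:ℝ), ENNReal.ofReal (‖f t‖ ^ 2 / t) < ⊤) ∧
          ∀ z ∈ RightHalfPlane, F z = normLaplace f z) := by
  exact ⟨fun f hf hi => ⟨nl_differentiableOn hf hi, nl_isometry hf hi⟩, fun F hF => nl_surj hF⟩

end
end
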